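/- Suppose b satisfies Assumption 1 with ρ ∈ (1,2), adopt the spectral setup and the finite element setup, assume the Ritz projection error bound holds, and let Q be a bounded self-adjoint nonnegative linear operator on H with nonnegative square root Q^{1/2}. Then there exists C > 0, independent of h, such that for every ν with 0 ≤ ν ≤ 2 and every t > 0: Σ_i ∫₀ᵗ ‖(S(u) − S_h(u)P_h) Q^{1/2} e_i‖² du ≤ C h^{2ν} Σ_i Σ_j λ_j^{ν − 1/ρ} (Q^{1/2} e_i, e_j)². (This is the noise contribution, obtained via Itô's isometry, to the strong error of the spatially semidiscrete approximation of the stochastic Volterra equation.) -/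

import Mathlib

open MeasureTheory Filter Set
open scoped ENNReal NNReal RealInnerProductSpace

noncomputable section

/-- The Laplace transform `b̂(z) = ∫₀^∞ e^{-zt} b(t) dt` of a real-valued kernel `b`. -/
def laplaceTransform (b : ℝ → ℝ) (z : ℂ) : ℂ :=
  ∫ t in Set.Ioi (0 : ℝ), Complex.exp (-z * t) * (b t : ℂ)

/-- Assumption 1: `b` is a nonzero, locally integrable, 3-monotone kernel
(with derivative `b'` on `(0,∞)`), `b(t) → 0` as `t → ∞`, and the angle condition
`ρ = 1 + (2/π) sup{|arg b̂(λ)| : Re λ > 0} ∈ (1,2)` holds. -/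
structure Assumption1 (b b' : ℝ → ℝ) (ρ : ℝ) : Prop where
  locInt : ∀ T > 0, IntegrableOn b (Set.Ioc 0 T)
  ne_zero : ∃ t > 0, b t ≠ 0
  nonneg : ∀ t > 0, 0 ≤ b t
  anti : AntitoneOn b (Set.Ioi 0)
  cvx : ConvexOn ℝ (Set.Ioi 0) b
  hasDeriv : ∀ t > 0, HasDerivAt b (b' t) t
  deriv_nonpos : ∀ t > 0, b' t ≤ 0
  deriv_anti : AntitoneOn (fun t => -(b' t)) (Set.Ioi 0)
  deriv_cvx : ConvexOn ℝ (Set.Ioi 0) (fun t => -(b' t))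
  tendsto_zero : Tendsto b atTop (nhds 0)
  rho_eq : ρ = 1 + (2 / Real.pi) *
      sSup {θ : ℝ | ∃ z : ℂ, 0 < z.re ∧ θ = |(laplaceTransform b z).arg|}
  rho_mem : ρ ∈ Set.Ioo (1 : ℝ) 2

/-- Assumption 2: `b̂` extends analytically to a sector `Σ_θ`, `θ > π/2`, with the
bounds `|b̂^{(k)}(z)| ≤ C |z|^{1-ρ-k}`, `k = 0,1`, there. -/
structure Assumption2 (b : ℝ → ℝ) (ρ θ : ℝ) : Prop where
  theta_gt : Real.pi / 2 < θ
  holo : ∃ B : ℂ → ℂ,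
    (∀ z : ℂ, z ≠ 0 → |z.arg| < θ → DifferentiableAt ℂ B z) ∧
    (∀ z : ℂ, 0 < z.re → B z = laplaceTransform b z) ∧
    ∃ C > 0, (∀ z : ℂ, z ≠ 0 → |z.arg| < θ → ‖B z‖ ≤ C * ‖z‖ ^ (1 - ρ)) ∧
      (∀ z : ℂ, z ≠ 0 → |z.arg| < θ → ‖deriv B z‖ ≤ C * ‖z‖ ^ (-ρ))

/-- `s` (with derivative `s'` on `(0,∞)`) solves the scalar Volterra equation
`s'(t) + λ ∫₀ᵗ b(t-u) s(u) du = 0`, `s(0) = 1`. -/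
structure IsScalarSolution (b : ℝ → ℝ) (lam : ℝ) (s s' : ℝ → ℝ) : Prop where
  init : s 0 = 1
  cont : ContinuousOn s (Set.Ici 0)
  hasDeriv : ∀ t > 0, HasDerivAt s (s' t) t
  eqn : ∀ t > 0, s' t + lam * ∫ u in (0 : ℝ)..t, b (t - u) * s u = 0

/-- The resolvent family `S(t)x = Σ_k s_k(t) (x,e_k) e_k`. -/
def Sop {H : Type*} [NormedAddCommGroup H] [InnerProductSpace ℝ H]
    (e : HilbertBasis ℕ ℝ H) (s : ℕ → ℝ → ℝ) (t : ℝ) (x : H) : H :=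
  ∑' k, (s k t * ⟪x, e k⟫) • (e k : H)

/-- The Backward Euler convolution quadrature operator
`B_k = ∫₀^∞ F(Δt s) e^{-s} s^{k-1}/(k-1)! ds`. -/
def quadB {H : Type*} [NormedAddCommGroup H] [NormedSpace ℝ H]
    (Δt : ℝ) (F : ℝ → H) (k : ℕ) : H :=
  ∫ u in Set.Ioi (0 : ℝ),
    (Real.exp (-u) * u ^ (k - 1) / (Nat.factorial (k - 1) : ℝ)) • F (Δt * u)

/-- The finite element setup: `f` is an orthonormal basis of the finite dimensional
subspace `V_h ⊆ D(A^{1/2})`, consisting of eigenvectors of the discrete operator `A_h`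
(defined via the bilinear form `a(u,v) = Σ_k λ_k (u,e_k)(v,e_k)`) with positive
eigenvalues `μ`. -/
structure FESetup {H : Type*} [NormedAddCommGroup H] [InnerProductSpace ℝ H]
    (e : HilbertBasis ℕ ℝ H) (lam : ℕ → ℝ) (N : ℕ) (f : Fin N → H) (μ : Fin N → ℝ) :
    Prop where
  f_orth : Orthonormal ℝ f
  mu_pos : ∀ j, 0 < μ j
  f_dom : ∀ j, (∑' k, ENNReal.ofReal (lam k * ⟪f j, e k⟫ ^ 2)) < ⊤
  eigen : ∀ j j', (∑' k, lam k * ⟪f j, e k⟫ * ⟪f j', e k⟫) = μ j * ⟪f j, f j'⟫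

section FourierHelpers

open scoped FourierTransform ContDiff

/-- The `L²` Fourier transform agrees almost everywhere with the Fourier integral on `L¹ ∩ L²`. -/
theorem coeFn_fourier_toLp {f : ℝ → ℂ} (hf : Integrable f) (hf2 : MemLp f 2) :
    ((𝓕 (hf2.toLp f) : Lp ℂ 2 (volume : Measure ℝ)) : ℝ → ℂ) =ᵐ[volume] 𝓕 f := by
  have hcont : Continuous (𝓕 f) :=
    VectorFourier.fourierIntegral_continuous Real.continuous_fourierChar
      (L := innerₗ ℝ) continuous_inner hf
  refine ae_eq_of_integral_contDiff_smul_eq ((Lp.memLp _).locallyIntegrable (by norm_num))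
    hcont.locallyIntegrable fun g hg hgc => ?_
  have hg₁ : HasCompactSupport (Complex.ofRealCLM ∘ g) := hgc.comp_left rfl
  have hg₂ : ContDiff ℝ ∞ (Complex.ofRealCLM ∘ g) := by fun_prop
  set φ : SchwartzMap ℝ ℂ := hg₁.toSchwartzMap hg₂ with hφ
  have hφx : ∀ x, φ x = (g x : ℂ) := fun x => rfl
  have key := congrArg (fun T => T φ) (Lp.fourier_toTemperedDistribution_eq (hf2.toLp f))
  simp only [TemperedDistribution.fourier_apply, Lp.toTemperedDistribution_apply] at key
  calc ∫ x, g x • ((𝓕 (hf2.toLp f) : Lp ℂ 2 (volume : Measure ℝ)) : ℝ → ℂ) x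
      = ∫ x, φ x • ((𝓕 (hf2.toLp f) : Lp ℂ 2 (volume : Measure ℝ)) : ℝ → ℂ) x := by
        refine integral_congr_ae (Eventually.of_forall fun x => ?_)
        simp [hφx]
    _ = ∫ x, (𝓕 φ : SchwartzMap ℝ ℂ) x • (hf2.toLp f : ℝ → ℂ) x := key.symm
    _ = ∫ x, (𝓕 φ : SchwartzMap ℝ ℂ) x • f x := by
        refine integral_congr_ae ?_
        filter_upwards [hf2.coeFn_toLp] with x hx
        rw [hx]
    _ = ∫ x, φ x • 𝓕 f x := by
        have := VectorFourier.integral_fourierIntegral_smul_eq_flip (L := innerₗ ℝ)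
          (μ := volume) (ν := volume)
          Real.continuous_fourierChar continuous_inner φ.integrable hf
        simpa [SchwartzMap.fourier_coe] using! this
    _ = ∫ x, g x • 𝓕 f x := by
        refine integral_congr_ae (Eventually.of_forall fun x => ?_)
        simp [hφx]

theorem memLp_fourier {f : ℝ → ℂ} (hf : Integrable f) (hf2 : MemLp f 2) :
    MemLp (𝓕 f) 2 := (memLp_congr_ae (coeFn_fourier_toLp hf hf2)).1 (Lp.memLp _)

/-- Plancherel's theorem for functions in `L¹ ∩ L²`. -/
theorem integral_conj_mul_fourier {f g : ℝ → ℂ} (hf : Integrable f) (hf2 : MemLp f 2)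
    (hg : Integrable g) (hg2 : MemLp g 2) :
    ∫ ξ, (starRingEnd ℂ) (𝓕 f ξ) * 𝓕 g ξ = ∫ x, (starRingEnd ℂ) (f x) * g x := by
  have h := Lp.inner_fourier_eq (hf2.toLp f) (hg2.toLp g)
  rw [L2.inner_def, L2.inner_def] at h
  refine Eq.trans ?_ (h.trans ?_) <;> refine integral_congr_ae ?_
  · filter_upwards [coeFn_fourier_toLp hf hf2, coeFn_fourier_toLp hg hg2] with x h1 h2
    rw [h1, h2, RCLike.inner_apply, mul_comm]
  · filter_upwards [hf2.coeFn_toLp, hg2.coeFn_toLp] with x h1 h2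
    rw [h1, h2, RCLike.inner_apply, mul_comm]

end FourierHelpers

theorem ConvexOn.antitoneOn_sub_shift {g : ℝ → ℝ} (hg : ConvexOn ℝ (Ioi 0) g) {a : ℝ}
    (ha : 0 < a) : AntitoneOn (fun t => g t - g (t + a)) (Ioi 0) := by
  intro x hx y hy hxy
  have hx' : (0 : ℝ) < x := hx
  have hL : 0 < y + a - x := by linarith
  have hmem : y + a ∈ Ioi (0 : ℝ) := by simp only [mem_Ioi]; linarith
  have e1 : a / (y + a - x) + (y - x) / (y + a - x) = 1 := by field_simp; ring
  have h1 := hg.2 hx hmem (div_nonneg ha.le hL.le)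
    (div_nonneg (sub_nonneg.2 hxy) hL.le) e1
  have h2 := hg.2 hx hmem (div_nonneg (sub_nonneg.2 hxy) hL.le) (div_nonneg ha.le hL.le)
    (by rw [add_comm]; exact e1)
  have e2 : (a / (y + a - x)) • x + ((y - x) / (y + a - x)) • (y + a) = y := by
    simp only [smul_eq_mul]; field_simp; ring
  have e3 : ((y - x) / (y + a - x)) • x + (a / (y + a - x)) • (y + a) = x + a := by
    simp only [smul_eq_mul]; field_simp; ring
  rw [e2] at h1
  rw [e3] at h2
  simp only [smul_eq_mul] at h1 h2
  have e4 : (y - x) / (y + a - x) = 1 - a / (y + a - x) := by linarith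
  rw [e4] at h1 h2
  simp only
  nlinarith

theorem IntegrableOn.bdd_mul_cont {φ k : ℝ → ℝ} {s : Set ℝ} (hφ : IntegrableOn φ s)
    (hk : Continuous k) (hb : ∀ t, |k t| ≤ 1) : IntegrableOn (fun t => k t * φ t) s :=
  Integrable.bdd_mul hφ hk.aestronglyMeasurable (c := 1) (Eventually.of_forall hb)

theorem integrableOn_comp_add {φ : ℝ → ℝ} {a c : ℝ} (h : IntegrableOn φ (Ioi (c + a))) :
    IntegrableOn (fun t => φ (t + a)) (Ioi c) := by
  have := (measurePreserving_add_right volume a).integrableOn_comp_preimage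
    (MeasurableEquiv.addRight a).measurableEmbedding (f := φ) (s := Ioi (c + a))
  have h2 := this.2 h
  simpa [Function.comp_def] using h2

theorem integral_Ioi_comp_add (φ : ℝ → ℝ) (a c : ℝ) :
    ∫ t in Ioi c, φ (t + a) = ∫ t in Ioi (c + a), φ t := by
  have := (measurePreserving_add_right volume a).setIntegral_preimage_emb
    (MeasurableEquiv.addRight a).measurableEmbedding φ (Ioi (c + a))
  simpa using this

/-- The sine transform of a nonnegative nonincreasing function is nonnegative. -/
theorem integral_sin_mul_nonneg {φ : ℝ → ℝ} (ha : AntitoneOn φ (Ioi 0))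
    (hi : IntegrableOn φ (Ioi 0)) : 0 ≤ ∫ t in Ioi 0, Real.sin t * φ t := by
  have hi' : IntegrableOn (fun t => Real.sin t * φ t) (Ioi 0) :=
    IntegrableOn.bdd_mul_cont hi Real.continuous_sin Real.abs_sin_le_one
  have hii : ∀ a c, 0 ≤ a → a ≤ c →
      IntervalIntegrable (fun t => Real.sin t * φ t) volume a c := fun a c h0 hac =>
    (intervalIntegrable_iff_integrableOn_Ioc_of_le hac).2
      (hi'.mono_set fun x hx => lt_of_le_of_lt h0 hx.1)
  have hper : ∀ n : ℕ, 0 ≤ ∫ t in (2 * Real.pi * n)..(2 * Real.pi * (n + 1)),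
      Real.sin t * φ t := by
    intro n
    have hpi := Real.pi_pos
    have hle : 2 * Real.pi * n ≤ 2 * Real.pi * (n + 1) := by nlinarith
    have h0 : (0 : ℝ) ≤ 2 * Real.pi * n := by positivity
    have hc : ∫ t in (2 * Real.pi * n)..(2 * Real.pi * (n + 1)),
        Real.sin t * φ (2 * Real.pi * n + Real.pi) = 0 := by
      rw [intervalIntegral.integral_mul_const, integral_sin]
      have e1 : Real.cos (2 * Real.pi * n) = 1 := by
        rw [mul_comm]; exact_mod_cast Real.cos_nat_mul_two_pi n
      have e2 : Real.cos (2 * Real.pi * (n + 1)) = 1 := by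
        rw [mul_comm]; exact_mod_cast Real.cos_nat_mul_two_pi (n + 1)
      rw [e1, e2]; simp
    rw [← hc]
    refine intervalIntegral.integral_mono_on_of_le_Ioo hle
      ((Real.continuous_sin.mul continuous_const).intervalIntegrable _ _) (hii _ _ h0 hle) ?_
    intro t ht
    have ht0 : 0 < t := lt_of_le_of_lt h0 ht.1
    have hmid : (0 : ℝ) < 2 * Real.pi * n + Real.pi := by linarith
    have hsin : Real.sin t = Real.sin (t - 2 * Real.pi * n) := by
      have := Real.sin_sub_nat_mul_two_pi t n
      rw [← this]; congr 1; ring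
    rcases le_total t (2 * Real.pi * n + Real.pi) with h | h
    · have : 0 ≤ Real.sin t := by
        rw [hsin]; exact Real.sin_nonneg_of_nonneg_of_le_pi (by linarith [ht.1]) (by linarith)
      exact mul_le_mul_of_nonneg_left (ha ht0 hmid h) this
    · have : Real.sin t ≤ 0 := by
        have e : Real.sin t = - Real.sin (t - 2 * Real.pi * n - Real.pi) := by
          rw [Real.sin_sub_pi, hsin, neg_neg]
        rw [e]
        have := Real.sin_nonneg_of_nonneg_of_le_pi (x := t - 2 * Real.pi * n - Real.pi)
          (by linarith) (by have := ht.2; linarith)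
        linarith
      exact mul_le_mul_of_nonpos_left (ha hmid ht0 h) this
  have hsum : ∀ n : ℕ, 0 ≤ ∫ t in (0 : ℝ)..(2 * Real.pi * n), Real.sin t * φ t := by
    intro n
    induction n with
    | zero => simp
    | succ n ih =>
      have hpi := Real.pi_pos
      have h0 : (0 : ℝ) ≤ 2 * Real.pi * n := by positivity
      push_cast
      rw [← intervalIntegral.integral_add_adjacent_intervals (hii 0 _ le_rfl h0)
        (hii _ (2 * Real.pi * (n + 1)) h0 (by nlinarith))]
      exact add_nonneg ih (hper n)
  have htend := intervalIntegral_tendsto_integral_Ioi 0 hi'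
    (tendsto_natCast_atTop_atTop.const_mul_atTop Real.two_pi_pos)
  exact ge_of_tendsto' htend hsum

theorem integral_Ioi_split {φ : ℝ → ℝ} {a c : ℝ} (hac : a ≤ c) (hi : IntegrableOn φ (Ioi a)) :
    ∫ t in Ioi a, φ t = (∫ t in Ioc a c, φ t) + ∫ t in Ioi c, φ t := by
  rw [← Ioc_union_Ioi_eq_Ioi hac]
  exact setIntegral_union (Ioc_disjoint_Ioi le_rfl) measurableSet_Ioi
    (hi.mono_set Ioc_subset_Ioi_self) (hi.mono_set (Ioi_subset_Ioi hac))

/-- The Fourier transform of a nonnegative, nonincreasing, convex, integrable function controls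
its integral near the origin. -/
theorem integral_Ioc_le_trig_integrals {g : ℝ → ℝ} (h0 : ∀ t > 0, 0 ≤ g t)
    (ha : AntitoneOn g (Ioi 0)) (hc : ConvexOn ℝ (Ioi 0) g) (hi : IntegrableOn g (Ioi 0)) :
    (1 / 2) * ∫ t in Ioc 0 (Real.pi / 2), g t ≤
      (∫ t in Ioi 0, Real.cos t * g t) + 5 * ∫ t in Ioi 0, Real.sin t * g t := by
  have hpi := Real.pi_pos
  have hsi : IntegrableOn (fun t => Real.sin t * g t) (Ioi 0) :=
    IntegrableOn.bdd_mul_cont hi Real.continuous_sin Real.abs_sin_le_one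
  have hci : IntegrableOn (fun t => Real.cos t * g t) (Ioi 0) :=
    IntegrableOn.bdd_mul_cont hi Real.continuous_cos Real.abs_cos_le_one
  have hshift : ∀ a, 0 < a → IntegrableOn (fun t => g (t + a)) (Ioi 0) := fun a h =>
    integrableOn_comp_add (hi.mono_set (Ioi_subset_Ioi (by linarith)))
  have hshift_sin : ∀ ψ : ℝ → ℝ, ∫ t in Ioi 0, Real.sin t * ψ (t + Real.pi) =
      -∫ t in Ioi Real.pi, Real.sin t * ψ t := by
    intro ψ
    have := integral_Ioi_comp_add (fun t => -(Real.sin t * ψ t)) Real.pi 0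
    simp only [Real.sin_add_pi, zero_add, neg_mul, neg_neg] at this
    rw [this, integral_neg]
  have hS : (1 / 2) * ∫ t in Ioc 0 Real.pi, Real.sin t * g t ≤
      ∫ t in Ioi 0, Real.sin t * g t := by
    have h1 := integral_sin_mul_nonneg (hc.antitoneOn_sub_shift hpi)
      (hi.sub (hshift _ hpi))
    simp only [mul_sub] at h1
    rw [integral_sub hsi (IntegrableOn.bdd_mul_cont (hshift _ hpi) Real.continuous_sin
      Real.abs_sin_le_one), hshift_sin, integral_Ioi_split hpi.le hsi] at h1
    rw [integral_Ioi_split hpi.le hsi]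
    linarith
  have hsin_nn : ∀ t ∈ Ioc 0 Real.pi, 0 ≤ Real.sin t := fun t ht =>
    Real.sin_nonneg_of_nonneg_of_le_pi ht.1.le ht.2
  have hS2 : ∫ t in Ioc 0 (Real.pi / 2), Real.sin t * g t ≤
      ∫ t in Ioc 0 Real.pi, Real.sin t * g t :=
    setIntegral_mono_set (hsi.mono_set Ioc_subset_Ioi_self)
      ((ae_restrict_iff' measurableSet_Ioc).2 (Eventually.of_forall fun t ht =>
        mul_nonneg (hsin_nn t ht) (h0 t ht.1)))
      (Eventually.of_forall (Ioc_subset_Ioc_right (by linarith)))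
  have hint_sin : ∀ c, 0 ≤ c → ∫ t in Ioc 0 c, Real.sin t = 1 - Real.cos c := by
    intro c hc
    rw [← intervalIntegral.integral_of_le hc, integral_sin, Real.cos_zero]
  have hm : (0 : ℝ) < Real.pi / 2 := by positivity
  have hS3 : g (Real.pi / 2) ≤ ∫ t in Ioc 0 (Real.pi / 2), Real.sin t * g t := by
    calc g (Real.pi / 2) = ∫ t in Ioc 0 (Real.pi / 2), Real.sin t * g (Real.pi / 2) := by
          rw [integral_mul_const, hint_sin _ hm.le]; simp
      _ ≤ _ := by
          refine setIntegral_mono_on ?_ (hsi.mono_set Ioc_subset_Ioi_self) measurableSet_Ioc ?_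
          · exact (Real.continuous_sin.mul continuous_const).integrableOn_Ioc
          · intro t ht
            exact mul_le_mul_of_nonneg_left (ha ht.1 hm ht.2)
              (hsin_nn t ⟨ht.1, by linarith [ht.2]⟩)
  have hC : ∫ t in Ioi (Real.pi / 2), Real.cos t * g t =
      -∫ t in Ioi 0, Real.sin t * g (t + Real.pi / 2) := by
    have := integral_Ioi_comp_add (fun t => Real.cos t * g t) (Real.pi / 2) 0
    rw [zero_add] at this
    rw [← this, ← integral_neg]
    simp [Real.cos_add_pi_div_two]
  have hsi2 : IntegrableOn (fun t => Real.sin t * g (t + Real.pi / 2)) (Ioi 0) :=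
    IntegrableOn.bdd_mul_cont (hshift _ hm) Real.continuous_sin Real.abs_sin_le_one
  have hC2 : ∫ t in Ioi 0, Real.sin t * g (t + Real.pi / 2) ≤ 2 * g (Real.pi / 2) := by
    rw [integral_Ioi_split hpi.le hsi2]
    have h1 : 0 ≤ ∫ t in Ioi 0, Real.sin t * g (t + Real.pi + Real.pi / 2) := by
      refine integral_sin_mul_nonneg (φ := fun t => g (t + Real.pi + Real.pi / 2)) ?_ ?_
      · intro x hx y hy hxy
        simp only [mem_Ioi] at hx hy
        exact ha (by simp only [mem_Ioi]; linarith) (by simp only [mem_Ioi]; linarith)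
          (by linarith)
      · have := hshift (Real.pi + Real.pi / 2) (by positivity)
        simpa only [add_assoc] using this
    rw [hshift_sin (fun t => g (t + Real.pi / 2))] at h1
    have h2 : ∫ t in Ioc 0 Real.pi, Real.sin t * g (t + Real.pi / 2) ≤
        ∫ t in Ioc 0 Real.pi, Real.sin t * g (Real.pi / 2) := by
      refine setIntegral_mono_on (hsi2.mono_set Ioc_subset_Ioi_self)
        (Real.continuous_sin.mul continuous_const).integrableOn_Ioc measurableSet_Ioc ?_
      intro t ht
      exact mul_le_mul_of_nonneg_left (ha hm (by simp only [mem_Ioi]; linarith [ht.1])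
        (by linarith [ht.1])) (hsin_nn t ht)
    rw [integral_mul_const, hint_sin _ hpi.le, Real.cos_pi] at h2
    linarith
  have hgi : IntegrableOn g (Ioc 0 (Real.pi / 2)) := hi.mono_set Ioc_subset_Ioi_self
  have hfin : ∫ t in Ioc 0 (Real.pi / 2), g t ≤
      (∫ t in Ioc 0 (Real.pi / 2), Real.cos t * g t) +
        ∫ t in Ioc 0 (Real.pi / 2), Real.sin t * g t := by
    rw [← integral_add (hci.mono_set Ioc_subset_Ioi_self) (hsi.mono_set Ioc_subset_Ioi_self)]
    refine setIntegral_mono_on hgi ((hci.mono_set Ioc_subset_Ioi_self).add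
      (hsi.mono_set Ioc_subset_Ioi_self)) measurableSet_Ioc ?_
    intro t ht
    have hs := hsin_nn t ⟨ht.1, by linarith [ht.2]⟩
    have hco : 0 ≤ Real.cos t := Real.cos_nonneg_of_mem_Icc ⟨by linarith [ht.1], ht.2⟩
    have hsum : 1 ≤ Real.cos t + Real.sin t := by
      nlinarith [Real.sin_sq_add_cos_sq t, mul_nonneg hs hco]
    nlinarith [h0 t ht.1]
  have hcos_nn : 0 ≤ ∫ t in Ioc 0 (Real.pi / 2), Real.cos t * g t :=
    setIntegral_nonneg measurableSet_Ioc fun t ht => mul_nonneg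
      (Real.cos_nonneg_of_mem_Icc ⟨by linarith [ht.1], ht.2⟩) (h0 t ht.1)
  rw [integral_Ioi_split hm.le hci, hC]
  linarith

/-- `u` is exponentially integrable: `e^{-σt} u(t)` is integrable on `(0,∞)` for all `σ > 0`. -/
def LaplaceIntegrable (u : ℝ → ℝ) : Prop :=
  ∀ σ > 0, IntegrableOn (fun t => Real.exp (-σ * t) * u t) (Ioi 0)

theorem exp_neg_mul_ofReal (z : ℂ) (t x : ℝ) :
    Complex.exp (-z * t) * (x : ℂ) =
      ((Real.cos (z.im * t) * (Real.exp (-z.re * t) * x) : ℝ) : ℂ) -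
        ((Real.sin (z.im * t) * (Real.exp (-z.re * t) * x) : ℝ) : ℂ) * Complex.I := by
  have h : -z * t = ((-z.re * t : ℝ) : ℂ) + ((-(z.im * t) : ℝ) : ℂ) * Complex.I := by
    apply Complex.ext <;> simp
  rw [h, Complex.exp_add_mul_I, ← Complex.ofReal_cos, ← Complex.ofReal_sin, ← Complex.ofReal_exp,
    Real.cos_neg, Real.sin_neg]
  push_cast
  ring

theorem LaplaceIntegrable.integrableOn_cexp {u : ℝ → ℝ} (hu : LaplaceIntegrable u) {z : ℂ}
    (hz : 0 < z.re) : IntegrableOn (fun t : ℝ => Complex.exp (-z * t) * (u t : ℂ)) (Ioi 0) := by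
  have h1 := (IntegrableOn.bdd_mul_cont (hu _ hz) (k := fun t => Real.cos (z.im * t))
    (by fun_prop) (fun t => Real.abs_cos_le_one _)).ofReal (𝕜 := ℂ)
  have h2 := (IntegrableOn.bdd_mul_cont (hu _ hz) (k := fun t => Real.sin (z.im * t))
    (by fun_prop) (fun t => Real.abs_sin_le_one _)).ofReal (𝕜 := ℂ)
  refine (h1.sub (h2.mul_const Complex.I)).congr (Eventually.of_forall fun t => ?_)
  exact (exp_neg_mul_ofReal z t (u t)).symm

theorem LaplaceIntegrable.laplaceTransform_eq {u : ℝ → ℝ} (hu : LaplaceIntegrable u) {z : ℂ}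
    (hz : 0 < z.re) : laplaceTransform u z =
      ((∫ t in Ioi 0, Real.cos (z.im * t) * (Real.exp (-z.re * t) * u t) : ℝ) : ℂ) -
        ((∫ t in Ioi 0, Real.sin (z.im * t) * (Real.exp (-z.re * t) * u t) : ℝ) : ℂ) *
          Complex.I := by
  have h1 := (IntegrableOn.bdd_mul_cont (hu _ hz) (k := fun t => Real.cos (z.im * t))
    (by fun_prop) (fun t => Real.abs_cos_le_one _)).ofReal (𝕜 := ℂ)
  have h2 := (IntegrableOn.bdd_mul_cont (hu _ hz) (k := fun t => Real.sin (z.im * t))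
    (by fun_prop) (fun t => Real.abs_sin_le_one _)).ofReal (𝕜 := ℂ)
  unfold laplaceTransform
  simp_rw [exp_neg_mul_ofReal]
  rw [← integral_complex_ofReal, ← integral_complex_ofReal, ← integral_mul_const]
  exact integral_sub h1 (h2.mul_const Complex.I)

theorem LaplaceIntegrable.re_laplaceTransform {u : ℝ → ℝ} (hu : LaplaceIntegrable u) {z : ℂ}
    (hz : 0 < z.re) : (laplaceTransform u z).re =
      ∫ t in Ioi 0, Real.cos (z.im * t) * (Real.exp (-z.re * t) * u t) := by
  rw [hu.laplaceTransform_eq hz]; simp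

theorem LaplaceIntegrable.im_laplaceTransform {u : ℝ → ℝ} (hu : LaplaceIntegrable u) {z : ℂ}
    (hz : 0 < z.re) : (laplaceTransform u z).im =
      -∫ t in Ioi 0, Real.sin (z.im * t) * (Real.exp (-z.re * t) * u t) := by
  rw [hu.laplaceTransform_eq hz]; simp

theorem laplaceTransform_conj (u : ℝ → ℝ) (z : ℂ) :
    laplaceTransform u (starRingEnd ℂ z) = starRingEnd ℂ (laplaceTransform u z) := by
  unfold laplaceTransform
  rw [← integral_conj]
  refine integral_congr_ae (Eventually.of_forall fun t => ?_)
  simp [← Complex.exp_conj]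

theorem LaplaceIntegrable.laplaceTransform_ofReal {u : ℝ → ℝ} (x : ℝ) :
    laplaceTransform u x = ((∫ t in Ioi 0, Real.exp (-x * t) * u t : ℝ) : ℂ) := by
  unfold laplaceTransform
  rw [← integral_complex_ofReal]
  refine integral_congr_ae (Eventually.of_forall fun t => ?_)
  push_cast
  simp

theorem LaplaceIntegrable.differentiableAt {u : ℝ → ℝ} (hu : LaplaceIntegrable u) {z : ℂ}
    (hz : 0 < z.re) : DifferentiableAt ℂ (laplaceTransform u) z := by
  have hmem : {w : ℂ | z.re / 2 < w.re} ∈ nhds z :=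
    (isOpen_lt continuous_const Complex.continuous_re).mem_nhds (show z.re / 2 < z.re by linarith)
  have h4 : (0 : ℝ) < z.re / 4 := by positivity
  refine (hasDerivAt_integral_of_dominated_loc_of_deriv_le (μ := volume.restrict (Ioi (0 : ℝ)))
    (F := fun (w : ℂ) (t : ℝ) => Complex.exp (-w * t) * (u t : ℂ))
    (F' := fun (w : ℂ) (t : ℝ) => -(t : ℂ) * (Complex.exp (-w * t) * (u t : ℂ)))
    (bound := fun t => 4 / z.re * |Real.exp (-(z.re / 4) * t) * u t|) hmem ?_
    (hu.integrableOn_cexp hz) ?_ ?_ ?_ ?_).2.differentiableAt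
  · filter_upwards [hmem] with w hw
    have hw : z.re / 2 < w.re := hw
    exact (hu.integrableOn_cexp (by linarith)).aestronglyMeasurable
  · exact AEStronglyMeasurable.mul (by fun_prop) (hu.integrableOn_cexp hz).aestronglyMeasurable
  · refine (ae_restrict_iff' measurableSet_Ioi).2 (Eventually.of_forall fun t ht w hw => ?_)
    have ht : 0 < t := ht
    have hw : z.re / 2 < w.re := hw
    rw [norm_mul, norm_mul, Complex.norm_exp, norm_neg, Complex.norm_real, Complex.norm_real,
      abs_mul, Real.abs_exp, Real.norm_eq_abs, Real.norm_eq_abs, abs_of_pos ht, ← mul_assoc,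
      ← mul_assoc]
    refine mul_le_mul_of_nonneg_right ?_ (abs_nonneg _)
    have e1 : (-w * t).re = -w.re * t := by simp
    rw [e1]
    have e2 : t ≤ 4 / z.re * Real.exp (z.re / 4 * t) := by
      have := Real.add_one_le_exp (z.re / 4 * t)
      rw [div_mul_eq_mul_div, le_div_iff₀ hz]
      nlinarith
    calc t * Real.exp (-w.re * t) ≤ 4 / z.re * Real.exp (z.re / 4 * t) * Real.exp (-w.re * t) :=
          mul_le_mul_of_nonneg_right e2 (Real.exp_pos _).le
      _ = 4 / z.re * Real.exp (z.re / 4 * t + -w.re * t) := by rw [mul_assoc, ← Real.exp_add]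
      _ ≤ _ := by gcongr; nlinarith
  · exact (hu _ h4).abs.const_mul _
  · refine Eventually.of_forall fun t w _ => ?_
    have := (((hasDerivAt_id w).neg.mul_const (t : ℂ)).cexp).mul_const (u t : ℂ)
    convert! this using 1
    simp; ring

namespace Assumption1

variable {b b' : ℝ → ℝ} {ρ : ℝ}

theorem laplaceIntegrable (hb : Assumption1 b b' ρ) : LaplaceIntegrable b := by
  intro σ hσ
  rw [← Ioc_union_Ioi_eq_Ioi zero_le_one]
  refine IntegrableOn.union ?_ ?_
  · have := (hb.locInt 1 one_pos)
    refine Integrable.bdd_mul this (c := 1) (by fun_prop) ?_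
    refine (ae_restrict_iff' measurableSet_Ioc).2 (Eventually.of_forall fun t ht => ?_)
    rw [Real.norm_eq_abs, Real.abs_exp, Real.exp_le_one_iff]
    nlinarith [ht.1]
  · have hm : AEStronglyMeasurable b (volume.restrict (Ioi 1)) :=
      (aemeasurable_restrict_of_antitoneOn measurableSet_Ioi
        (hb.anti.mono (Ioi_subset_Ioi zero_le_one))).aestronglyMeasurable
    refine Integrable.mul_bdd (c := b 1) (exp_neg_integrableOn_Ioi 1 hσ) hm ?_
    refine (ae_restrict_iff' measurableSet_Ioi).2 (Eventually.of_forall fun t ht => ?_)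
    have ht : (1 : ℝ) < t := ht
    have ht0 : (0 : ℝ) < t := by linarith
    rw [Real.norm_eq_abs, abs_of_nonneg (hb.nonneg t ht0)]
    exact hb.anti (mem_Ioi.2 one_pos) (mem_Ioi.2 ht0) ht.le

theorem exists_pos (hb : Assumption1 b b' ρ) : ∃ δ > 0, ∀ t, 0 < t → t ≤ δ → 0 < b t := by
  obtain ⟨t₀, h0, h1⟩ := hb.ne_zero
  exact ⟨t₀, h0, fun t ht htt => lt_of_lt_of_le (lt_of_le_of_ne (hb.nonneg _ h0) h1.symm)
    (hb.anti (mem_Ioi.2 ht) (mem_Ioi.2 h0) htt)⟩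

theorem integral_pos (hb : Assumption1 b b' ρ) {σ a : ℝ} (hσ : 0 < σ) (ha : 0 < a) :
    0 < ∫ t in Ioc 0 a, Real.exp (-σ * t) * b t := by
  obtain ⟨δ, hδ, hpos⟩ := hb.exists_pos
  have hm : 0 < min a δ := lt_min ha hδ
  have hint : IntegrableOn (fun t => Real.exp (-σ * t) * b t) (Ioc 0 a) :=
    (hb.laplaceIntegrable σ hσ).mono_set Ioc_subset_Ioi_self
  rw [setIntegral_pos_iff_support_of_nonneg_ae _ hint]
  · refine lt_of_lt_of_le ?_ (measure_mono (s := Ioc 0 (min a δ)) fun t ht => ?_)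
    · simp [ha, hδ]
    · exact ⟨(mul_pos (Real.exp_pos _) (hpos t ht.1 (ht.2.trans (min_le_right _ _)))).ne',
        ht.1, ht.2.trans (min_le_left _ _)⟩
  · refine (ae_restrict_iff' measurableSet_Ioc).2 (Eventually.of_forall fun t ht => ?_)
    exact mul_nonneg (Real.exp_pos _).le (hb.nonneg t ht.1)

/-- Lower bound for the Laplace transform of a convex kernel off the real axis. -/
theorem integral_Ioc_le_norm_laplace_of_pos (hb : Assumption1 b b' ρ) {z : ℂ} (hz : 0 < z.re)
    (hi : 0 < z.im) : ∫ t in Ioc 0 (Real.pi / (2 * z.im)), Real.exp (-z.re * t) * b t ≤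
      12 * ‖laplaceTransform b z‖ := by
  have hu := hb.laplaceIntegrable
  set w := z.im with hw
  set σ := z.re with hσ
  set g : ℝ → ℝ := fun t => Real.exp (-σ * (w⁻¹ * t)) * b (w⁻¹ * t) with hg
  have hw' : 0 < w⁻¹ := inv_pos.2 hi
  have hmem : ∀ t ∈ Ioi (0 : ℝ), w⁻¹ * t ∈ Ioi (0 : ℝ) := fun t ht => mul_pos hw' ht
  have e0 : ∀ t ∈ Ioi (0:ℝ), 0 ≤ b (w⁻¹ * t) := fun t ht => hb.nonneg _ (hmem t ht)
  have a1 : AntitoneOn (fun t => Real.exp (-σ * (w⁻¹ * t))) (Ioi 0) := by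
    intro x _ y _ hxy
    refine Real.exp_le_exp.2 ?_
    have := mul_le_mul_of_nonneg_left hxy hw'.le
    nlinarith
  have a2 : AntitoneOn (fun t => b (w⁻¹ * t)) (Ioi 0) := fun x hx y hy hxy =>
    hb.anti (hmem x hx) (hmem y hy) (mul_le_mul_of_nonneg_left hxy hw'.le)
  have c1 : ConvexOn ℝ (Ioi 0) (fun t => Real.exp (-σ * (w⁻¹ * t))) := by
    refine ⟨convex_Ioi 0, fun x _ y _ p q hp hq hpq => ?_⟩
    have := convexOn_exp.2 (mem_univ (-σ * (w⁻¹ * x))) (mem_univ (-σ * (w⁻¹ * y))) hp hq hpq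
    refine le_trans (le_of_eq ?_) this
    simp only [smul_eq_mul]; ring_nf
  have c2 : ConvexOn ℝ (Ioi 0) (fun t => b (w⁻¹ * t)) := by
    refine ⟨convex_Ioi 0, fun x hx y hy p q hp hq hpq => ?_⟩
    have := hb.cvx.2 (hmem x hx) (hmem y hy) hp hq hpq
    refine le_trans (le_of_eq ?_) this
    simp only [smul_eq_mul]; ring_nf
  have key := integral_Ioc_le_trig_integrals (g := g)
    (fun t ht => mul_nonneg (Real.exp_pos _).le (e0 t ht))
    (fun x hx y hy hxy => mul_le_mul (a1 hx hy hxy) (a2 hx hy hxy) (e0 y hy) (Real.exp_pos _).le)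
    (c1.mul c2 (fun _ _ => (Real.exp_pos _).le) e0 (a1.monovaryOn a2))
    ((integrableOn_Ioi_comp_mul_left_iff (fun t => Real.exp (-σ * t) * b t) 0 hw').2
      (by rw [mul_zero]; exact hu σ hz))
  have t1 : ∀ ψ : ℝ → ℝ, ∫ t in Ioi 0, ψ t * g t =
      w * ∫ t in Ioi 0, ψ (w * t) * (Real.exp (-σ * t) * b t) := by
    intro ψ
    have := integral_comp_mul_left_Ioi
      (fun t => ψ (w * t) * (Real.exp (-σ * t) * b t)) 0 hw'
    rw [mul_zero, inv_inv, smul_eq_mul] at this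
    rw [← this]
    refine integral_congr_ae (Eventually.of_forall fun t => ?_)
    simp only [hg]
    rw [mul_inv_cancel_left₀ hi.ne']
  have t2 : ∫ t in Ioc 0 (Real.pi / 2), g t =
      w * ∫ t in Ioc 0 (Real.pi / (2 * w)), Real.exp (-σ * t) * b t := by
    have hpi := Real.pi_pos
    rw [← intervalIntegral.integral_of_le (by positivity),
      ← intervalIntegral.integral_of_le (by positivity)]
    have := intervalIntegral.integral_comp_mul_left (a := 0) (b := Real.pi / 2)
      (fun t => Real.exp (-σ * t) * b t) hw'.ne'
    rw [this, mul_zero, inv_inv, smul_eq_mul]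
    congr 2
    field_simp
  rw [t1, t1, t2, ← hu.re_laplaceTransform hz] at key
  have him := hu.im_laplaceTransform hz
  rw [← hw] at him
  have hre := Complex.abs_re_le_norm (laplaceTransform b z)
  have him' := Complex.abs_im_le_norm (laplaceTransform b z)
  have k2 : (1 / 2) * (∫ t in Ioc 0 (Real.pi / (2 * w)), Real.exp (-σ * t) * b t) ≤
      (laplaceTransform b z).re + 5 * (-(laplaceTransform b z).im) := by
    rw [him, neg_neg]
    refine le_of_mul_le_mul_left ?_ hi
    linarith
  have := le_abs_self (laplaceTransform b z).re
  have := neg_abs_le (laplaceTransform b z).im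
  linarith

theorem integral_Ioc_le_norm_laplace (hb : Assumption1 b b' ρ) {z : ℂ} (hz : 0 < z.re)
    (hi : z.im ≠ 0) : ∫ t in Ioc 0 (Real.pi / (2 * |z.im|)), Real.exp (-z.re * t) * b t ≤
      12 * ‖laplaceTransform b z‖ := by
  rcases lt_or_gt_of_ne hi with h | h
  · have := hb.integral_Ioc_le_norm_laplace_of_pos (z := starRingEnd ℂ z) (by simpa) (by simpa)
    rw [laplaceTransform_conj, RCLike.norm_conj] at this
    rw [abs_of_neg h]
    simpa using this
  · rw [abs_of_pos h]
    exact hb.integral_Ioc_le_norm_laplace_of_pos hz h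

theorem laplace_ofReal_pos (hb : Assumption1 b b' ρ) {x : ℝ} (hx : 0 < x) :
    0 < ∫ t in Ioi 0, Real.exp (-x * t) * b t := by
  refine lt_of_lt_of_le (hb.integral_pos hx one_pos) ?_
  refine setIntegral_mono_set (hb.laplaceIntegrable x hx) ?_ Ioc_subset_Ioi_self.eventuallyLE
  refine (ae_restrict_iff' measurableSet_Ioi).2 (Eventually.of_forall fun t ht => ?_)
  exact mul_nonneg (Real.exp_pos _).le (hb.nonneg t ht)

theorem laplace_ne_zero (hb : Assumption1 b b' ρ) {z : ℂ} (hz : 0 < z.re) :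
    laplaceTransform b z ≠ 0 := by
  by_cases hi : z.im = 0
  · have : z = (z.re : ℂ) := by apply Complex.ext <;> simp [hi]
    rw [this, LaplaceIntegrable.laplaceTransform_ofReal]
    exact_mod_cast (hb.laplace_ofReal_pos hz).ne'
  · have h1 := hb.integral_Ioc_le_norm_laplace hz hi
    have hpi := Real.pi_pos
    have h2 := hb.integral_pos hz (a := Real.pi / (2 * |z.im|)) (by positivity)
    intro h
    rw [h, norm_zero, mul_zero] at h1
    linarith

end Assumption1

/-- A Schwarz–Pick inequality on the right half-plane. -/
theorem schwarzPick_halfPlane {F : ℂ → ℂ} (hF : DifferentiableOn ℂ F {z | 0 < z.re})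
    (hpos : ∀ z : ℂ, 0 < z.re → 0 < (F z).re) {x y a c : ℝ} (hx : 0 < x) (hxy : x < y)
    (ha : F x = a) (hc : F y = c) : a * x ≤ c * y := by
  have hy : 0 < y := hx.trans hxy
  have ha0 : 0 < a := by have := hpos x (by simpa); rwa [ha, Complex.ofReal_re] at this
  have hc0 : 0 < c := by have := hpos y (by simpa); rwa [hc, Complex.ofReal_re] at this
  have hne1 : ∀ w ∈ Metric.ball (0 : ℂ) 1, (1 - w) ≠ 0 := by
    intro w hw h
    have : w = 1 := by linear_combination -h
    rw [this] at hw
    simp at hw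
  set m : ℂ → ℂ := fun w => x * ((1 + w) / (1 - w)) with hm
  have hmre : ∀ w ∈ Metric.ball (0 : ℂ) 1, 0 < (m w).re := by
    intro w hw
    have h1 := hne1 w hw
    have h2 : 0 < Complex.normSq (1 - w) := Complex.normSq_pos.2 h1
    have h3 : Complex.normSq w < 1 := by
      rw [Complex.normSq_eq_norm_sq]
      have : ‖w‖ < 1 := by simpa using hw
      have := norm_nonneg w
      nlinarith
    simp only [hm, Complex.re_ofReal_mul, Complex.div_re]
    rw [← add_div]
    refine mul_pos hx (div_pos ?_ h2)
    simp [Complex.normSq_apply] at h3 ⊢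
    nlinarith
  set G : ℂ → ℂ := fun w => (F (m w) - a) / (F (m w) + a) with hG
  have hne2 : ∀ w ∈ Metric.ball (0 : ℂ) 1, F (m w) + a ≠ 0 := by
    intro w hw h
    have := hpos _ (hmre w hw)
    have h' := congrArg Complex.re h
    simp at h'
    linarith
  have hmd : DifferentiableOn ℂ m (Metric.ball 0 1) :=
    ((differentiableOn_id.const_add 1).div (differentiableOn_id.const_sub 1) hne1).const_mul _
  have hFm : DifferentiableOn ℂ (fun w => F (m w)) (Metric.ball 0 1) := hF.comp hmd hmre
  have hGd : DifferentiableOn ℂ G (Metric.ball 0 1) :=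
    (hFm.sub_const _).div (hFm.add_const _) hne2
  have hGm : MapsTo G (Metric.ball 0 1) (Metric.closedBall 0 1) := by
    intro w hw
    have h1 := hpos _ (hmre w hw)
    simp only [Metric.mem_closedBall, dist_zero_right, hG, norm_div]
    refine div_le_one_of_le₀ ?_ (norm_nonneg _)
    rw [Complex.norm_def, Complex.norm_def]
    refine Real.sqrt_le_sqrt ?_
    simp only [Complex.normSq_apply, Complex.sub_re, Complex.add_re, Complex.sub_im,
      Complex.add_im, Complex.ofReal_re, Complex.ofReal_im]
    nlinarith [mul_pos h1 ha0]
  have hw0 : (0 : ℝ) ≤ (y - x) / (y + x) := div_nonneg (by linarith) (by linarith)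
  have hw1 : ‖(((y - x) / (y + x) : ℝ) : ℂ)‖ < 1 := by
    rw [Complex.norm_real, Real.norm_eq_abs, abs_of_nonneg hw0, div_lt_one (by linarith)]
    linarith
  have hG0 : G 0 = 0 := by simp [hG, hm, ha]
  have key := Complex.norm_le_norm_of_mapsTo_ball hGd hGm hG0 hw1
  have hmw : m (((y - x) / (y + x) : ℝ) : ℂ) = y := by
    simp only [hm]
    norm_cast
    have h1 : y + x ≠ 0 := by linarith
    have h2 : 1 - (y - x) / (y + x) = 2 * x / (y + x) := by field_simp; ring
    have h3 : 1 + (y - x) / (y + x) = 2 * y / (y + x) := by field_simp; ring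
    rw [h2, h3]
    field_simp
  simp only [hG, hmw, hc] at key
  norm_cast at key
  rw [Real.norm_eq_abs, Real.norm_eq_abs, abs_of_nonneg hw0] at key
  have k2 := (neg_le_abs _).trans key
  rw [← neg_div, div_le_div_iff₀ (by linarith) (by linarith)] at k2
  nlinarith

namespace Assumption1

variable {b b' : ℝ → ℝ} {ρ : ℝ}

theorem abs_arg_le (hb : Assumption1 b b' ρ) {z : ℂ} (hz : 0 < z.re) :
    |(laplaceTransform b z).arg| ≤ (ρ - 1) * (Real.pi / 2) := by
  have hle : |(laplaceTransform b z).arg| ≤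
      sSup {θ : ℝ | ∃ z : ℂ, 0 < z.re ∧ θ = |(laplaceTransform b z).arg|} := by
    refine le_csSup ⟨Real.pi, ?_⟩ ⟨z, hz, rfl⟩
    rintro _ ⟨w, _, rfl⟩
    exact Complex.abs_arg_le_pi _
  have hpi := Real.pi_pos
  refine hle.trans (le_of_eq ?_)
  have := hb.rho_eq
  have h2 : ρ - 1 = 2 / Real.pi *
      sSup {θ : ℝ | ∃ z : ℂ, 0 < z.re ∧ θ = |(laplaceTransform b z).arg|} := by linarith
  rw [h2]
  field_simp

theorem angle_lt (hb : Assumption1 b b' ρ) : (ρ - 1) * (Real.pi / 2) < Real.pi / 2 := by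
  have := hb.rho_mem.2
  have hpi := Real.pi_pos
  nlinarith

theorem angle_pos (hb : Assumption1 b b' ρ) : 0 < (ρ - 1) * (Real.pi / 2) := by
  have := hb.rho_mem.1
  have hpi := Real.pi_pos
  nlinarith

theorem cos_angle_pos (hb : Assumption1 b b' ρ) : 0 < Real.cos ((ρ - 1) * (Real.pi / 2)) :=
  Real.cos_pos_of_mem_Ioo ⟨by linarith [hb.angle_pos, Real.pi_pos], hb.angle_lt⟩

theorem cos_mul_norm_le_re (hb : Assumption1 b b' ρ) {z : ℂ} (hz : 0 < z.re) :
    Real.cos ((ρ - 1) * (Real.pi / 2)) * ‖laplaceTransform b z‖ ≤ (laplaceTransform b z).re := by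
  have h1 := hb.abs_arg_le hz
  have h2 := Real.cos_le_cos_of_nonneg_of_le_pi (abs_nonneg _)
    (by linarith [hb.angle_lt, Real.pi_pos]) h1
  rw [Real.cos_abs] at h2
  rw [← Complex.norm_mul_cos_arg (laplaceTransform b z), mul_comm]
  exact mul_le_mul_of_nonneg_left h2 (norm_nonneg _)

theorem re_laplace_pos (hb : Assumption1 b b' ρ) {z : ℂ} (hz : 0 < z.re) :
    0 < (laplaceTransform b z).re :=
  lt_of_lt_of_le (mul_pos hb.cos_angle_pos (norm_pos_iff.2 (hb.laplace_ne_zero hz)))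
    (hb.cos_mul_norm_le_re hz)

theorem laplace_mul_rpow_le (hb : Assumption1 b b' ρ) {p x y : ℝ} (hp : 0 < p)
    (hp' : p < 1 / (ρ - 1)) (hx : 0 < x) (hxy : x < y) :
    (∫ t in Ioi 0, Real.exp (-x * t) * b t) ^ p * x ≤
      (∫ t in Ioi 0, Real.exp (-y * t) * b t) ^ p * y := by
  have hy : 0 < y := hx.trans hxy
  have hρ : 0 < ρ - 1 := by linarith [hb.rho_mem.1]
  refine schwarzPick_halfPlane (F := fun z => laplaceTransform b z ^ (p : ℂ)) ?_ ?_ hx hxy ?_ ?_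
  · intro z hz
    exact ((hb.laplaceIntegrable.differentiableAt hz).cpow_const
      (Or.inl (hb.re_laplace_pos hz))).differentiableWithinAt
  · intro z hz
    have h0 := hb.laplace_ne_zero hz
    rw [Complex.cpow_def_of_ne_zero h0, Complex.exp_re]
    refine mul_pos (Real.exp_pos _) (Real.cos_pos_of_mem_Ioo ?_)
    have e : (Complex.log (laplaceTransform b z) * p).im = p * (laplaceTransform b z).arg := by
      simp [mul_comm, Complex.log_im]
    have h3 : |p * (laplaceTransform b z).arg| < Real.pi / 2 := by
      rw [abs_mul, abs_of_pos hp]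
      have hpi := Real.pi_pos
      have hp2 : p * (ρ - 1) < 1 := (lt_div_iff₀ hρ).1 hp'
      calc p * |(laplaceTransform b z).arg| ≤ p * ((ρ - 1) * (Real.pi / 2)) :=
            mul_le_mul_of_nonneg_left (hb.abs_arg_le hz) hp.le
        _ < Real.pi / 2 := by nlinarith
    rw [e]
    exact abs_lt.1 h3
  · rw [LaplaceIntegrable.laplaceTransform_ofReal, Complex.ofReal_cpow (hb.laplace_ofReal_pos hx).le]
  · rw [LaplaceIntegrable.laplaceTransform_ofReal, Complex.ofReal_cpow (hb.laplace_ofReal_pos hy).le]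

theorem laplace_one_le (hb : Assumption1 b b' ρ) {y : ℝ} (hy : 1 ≤ y) :
    (∫ t in Ioi 0, Real.exp (-1 * t) * b t) * y ^ (1 - ρ) ≤
      ∫ t in Ioi 0, Real.exp (-y * t) * b t := by
  rcases hy.eq_or_lt with rfl | hy
  · simp
  have hρ : 0 < ρ - 1 := by linarith [hb.rho_mem.1]
  have hy0 : 0 < y := by linarith
  set B1 := ∫ t in Ioi 0, Real.exp (-1 * t) * b t
  set By := ∫ t in Ioi 0, Real.exp (-y * t) * b t
  have h1 : 0 < B1 := hb.laplace_ofReal_pos one_pos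
  have h2 : 0 < By := hb.laplace_ofReal_pos hy0
  have hlim : ∀ {B : ℝ}, 0 < B → Tendsto (fun p : ℝ => B ^ p) (nhdsWithin (1 / (ρ - 1))
      (Iio (1 / (ρ - 1)))) (nhds (B ^ (1 / (ρ - 1)))) := fun hB =>
    ((Real.continuous_const_rpow hB.ne').tendsto _).mono_left nhdsWithin_le_nhds
  have key : B1 ^ (1 / (ρ - 1)) * 1 ≤ By ^ (1 / (ρ - 1)) * y := by
    refine le_of_tendsto_of_tendsto ((hlim h1).mul_const 1) ((hlim h2).mul_const y) ?_
    filter_upwards [Ioo_mem_nhdsLT (show 0 < 1 / (ρ - 1) by positivity)] with p hp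
    exact hb.laplace_mul_rpow_le hp.1 hp.2 one_pos hy
  have k2 := Real.rpow_le_rpow (by positivity) key hρ.le
  rw [mul_one, Real.mul_rpow (by positivity) hy0.le, ← Real.rpow_mul h1.le, ← Real.rpow_mul h2.le,
    one_div_mul_cancel hρ.ne', Real.rpow_one, Real.rpow_one] at k2
  calc B1 * y ^ (1 - ρ) ≤ By * y ^ (ρ - 1) * y ^ (1 - ρ) := by gcongr
    _ = By := by
      rw [mul_assoc, ← Real.rpow_add hy0]; simp

theorem laplace_le_integral (hb : Assumption1 b b' ρ) {ω : ℝ} (hω : 0 < ω) :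
    ∫ t in Ioi 0, Real.exp (-ω * t) * b t ≤
      2 * ∫ t in Ioc 0 (Real.pi / (2 * ω)), b t := by
  have hpi := Real.pi_pos
  have hpi2 := Real.pi_gt_three
  set a := Real.pi / (2 * ω) with ha
  have ha0 : 0 < a := by positivity
  have hint := hb.laplaceIntegrable ω hω
  rw [integral_Ioi_split ha0.le hint, two_mul]
  refine add_le_add ?_ ?_
  · refine setIntegral_mono_on (hint.mono_set Ioc_subset_Ioi_self) (hb.locInt a ha0)
      measurableSet_Ioc fun t ht => ?_
    refine mul_le_of_le_one_left (hb.nonneg t ht.1) (Real.exp_le_one_iff.2 ?_)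
    nlinarith [ht.1]
  · calc ∫ t in Ioi a, Real.exp (-ω * t) * b t ≤ ∫ t in Ioi a, Real.exp (-ω * t) * b a := by
          refine setIntegral_mono_on (hint.mono_set (Ioi_subset_Ioi ha0.le))
            ((exp_neg_integrableOn_Ioi a hω).mul_const _) measurableSet_Ioi fun t ht => ?_
          refine mul_le_mul_of_nonneg_left ?_ (Real.exp_pos _).le
          exact hb.anti (mem_Ioi.2 ha0) (mem_Ioi.2 (ha0.trans ht)) (le_of_lt ht)
      _ = Real.exp (-ω * a) / ω * b a := by
          rw [integral_mul_const, integral_exp_mul_Ioi (by linarith) a, neg_div_neg_eq]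
      _ ≤ a * b a := by
          refine mul_le_mul_of_nonneg_right ?_ (hb.nonneg a ha0)
          rw [ha, div_le_div_iff₀ hω (by positivity)]
          have : Real.exp (-ω * a) ≤ 1 := Real.exp_le_one_iff.2 (by nlinarith)
          nlinarith
      _ = ∫ t in Ioc 0 a, b a := by simp [ha0.le]
      _ ≤ ∫ t in Ioc 0 a, b t := by
          refine setIntegral_mono_on (by simp) (hb.locInt a ha0) measurableSet_Ioc fun t ht => ?_
          exact hb.anti (mem_Ioi.2 ht.1) (mem_Ioi.2 ha0) ht.2

/-- Lower bound for the Laplace transform near the imaginary axis. -/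
theorem exists_le_norm_laplace (hb : Assumption1 b b' ρ) : ∃ c > 0, ∀ z : ℂ, 0 < z.re → z.re ≤ 1 →
    z.im ≠ 0 → c * max 1 |z.im| ^ (1 - ρ) ≤ ‖laplaceTransform b z‖ := by
  have hpi := Real.pi_pos
  have hpi2 := Real.pi_gt_three
  have hpi4 := Real.pi_lt_four
  set c₁ := ∫ t in Ioc 0 1, Real.exp (-1 * t) * b t
  set c₂ := ∫ t in Ioi 0, Real.exp (-1 * t) * b t
  have h1 : 0 < c₁ := hb.integral_pos one_pos one_pos
  have h2 : 0 < c₂ := hb.laplace_ofReal_pos one_pos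
  have hnn : ∀ (σ : ℝ) (A : Set ℝ), A ⊆ Ioi 0 → MeasurableSet A →
      0 ≤ᵐ[volume.restrict A] fun t => Real.exp (-σ * t) * b t := fun σ A hA hm =>
    (ae_restrict_iff' hm).2 (Eventually.of_forall fun t ht =>
      mul_nonneg (Real.exp_pos _).le (hb.nonneg t (hA ht)))
  refine ⟨min (c₁ / 12) (Real.exp (-2) * c₂ / 24), by positivity, fun z hz hz1 hi => ?_⟩
  have hw : 0 < |z.im| := abs_pos.2 hi
  have key := hb.integral_Ioc_le_norm_laplace hz hi
  have hI := hb.laplaceIntegrable z.re hz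
  have ha0 : 0 < Real.pi / (2 * |z.im|) := by positivity
  rcases le_total |z.im| 1 with h | h
  · rw [max_eq_left h, Real.one_rpow, mul_one]
    refine (min_le_left _ _).trans ?_
    have : c₁ ≤ ∫ t in Ioc 0 (Real.pi / (2 * |z.im|)), Real.exp (-z.re * t) * b t := by
      calc c₁ ≤ ∫ t in Ioc 0 1, Real.exp (-z.re * t) * b t := by
            refine setIntegral_mono_on ((hb.laplaceIntegrable 1 one_pos).mono_set
              Ioc_subset_Ioi_self) (hI.mono_set Ioc_subset_Ioi_self) measurableSet_Ioc
              fun t ht => ?_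
            refine mul_le_mul_of_nonneg_right (Real.exp_le_exp.2 ?_) (hb.nonneg t ht.1)
            nlinarith [ht.1]
        _ ≤ _ := by
            refine setIntegral_mono_set (hI.mono_set Ioc_subset_Ioi_self)
              (hnn _ _ Ioc_subset_Ioi_self measurableSet_Ioc)
              (Ioc_subset_Ioc_right ?_).eventuallyLE
            rw [le_div_iff₀ (by positivity)]
            linarith
    linarith
  · rw [max_eq_right h]
    have e1 := hb.laplace_one_le h
    have e2 := hb.laplace_le_integral hw
    have e3 : Real.exp (-2) * ∫ t in Ioc 0 (Real.pi / (2 * |z.im|)), b t ≤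
        ∫ t in Ioc 0 (Real.pi / (2 * |z.im|)), Real.exp (-z.re * t) * b t := by
      rw [← integral_const_mul]
      refine setIntegral_mono_on ((hb.locInt _ ha0).const_mul _)
        (hI.mono_set Ioc_subset_Ioi_self) measurableSet_Ioc fun t ht => ?_
      refine mul_le_mul_of_nonneg_right (Real.exp_le_exp.2 ?_) (hb.nonneg t ht.1)
      have : t ≤ 2 := ht.2.trans (by rw [div_le_iff₀ (by positivity)]; linarith)
      nlinarith [ht.1]
    have e4 : c₂ * |z.im| ^ (1 - ρ) ≤ 2 * ∫ t in Ioc 0 (Real.pi / (2 * |z.im|)), b t := e1.trans e2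
    have e5 := mul_le_mul_of_nonneg_left e4 (Real.exp_pos (-2)).le
    calc _ ≤ Real.exp (-2) * c₂ / 24 * |z.im| ^ (1 - ρ) :=
          mul_le_mul_of_nonneg_right (min_le_right _ _) (by positivity)
      _ ≤ _ := by linarith

/-- Coercivity of `z + λ b̂(z)`. -/
theorem norm_add_le (hb : Assumption1 b b' ρ) {z : ℂ} (hz : 0 < z.re) {l : ℝ} (hl : 0 < l) :
    ‖z‖ + l * ‖laplaceTransform b z‖ ≤ (1 + 2 / Real.cos ((ρ - 1) * (Real.pi / 2))) *
      ‖z + l * laplaceTransform b z‖ := by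
  have hκ := hb.cos_angle_pos
  set κ := Real.cos ((ρ - 1) * (Real.pi / 2))
  set B := laplaceTransform b z with hB
  have h1 : κ * (l * ‖B‖) ≤ ‖z + l * B‖ := by
    refine le_trans ?_ (Complex.re_le_norm _)
    have := mul_le_mul_of_nonneg_left (hb.cos_mul_norm_le_re hz) hl.le
    rw [Complex.add_re, Complex.re_ofReal_mul]
    linarith
  have h2 : l * ‖B‖ ≤ ‖z + l * B‖ / κ := by rw [le_div_iff₀ hκ]; linarith
  have h3 : ‖z‖ ≤ ‖z + l * B‖ + l * ‖B‖ := by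
    have := norm_sub_le (z + l * B) (l * B)
    rw [add_sub_cancel_right, norm_mul, Complex.norm_real, Real.norm_eq_abs, abs_of_pos hl] at this
    exact this
  have : (1 + 2 / κ) * ‖z + l * B‖ = ‖z + l * B‖ + 2 * (‖z + l * B‖ / κ) := by ring
  linarith

theorem add_mul_laplace_ne_zero (hb : Assumption1 b b' ρ) {z : ℂ} (hz : 0 < z.re) {l : ℝ}
    (hl : 0 < l) : z + l * laplaceTransform b z ≠ 0 := by
  intro h
  have := congrArg Complex.re h
  rw [Complex.add_re, Complex.re_ofReal_mul, Complex.zero_re] at this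
  have := mul_pos hl (hb.re_laplace_pos hz)
  linarith

end Assumption1

section FourierHelpers

open scoped FourierTransform ContDiff

/-- The Volterra convolution `∫₀ᵗ b(t-x) u(x) dx`. -/
def volterraConv (b u : ℝ → ℝ) (t : ℝ) : ℝ := ∫ x in (0 : ℝ)..t, b (t - x) * u x

theorem LaplaceIntegrable.volterraConv {b u : ℝ → ℝ} (hb : LaplaceIntegrable b)
    (hu : LaplaceIntegrable u) : LaplaceIntegrable (volterraConv b u) := by
  intro σ hσ
  have := integrable_posConvolution (hu σ hσ) (hb σ hσ) (ContinuousLinearMap.mul ℝ ℝ)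
  rw [posConvolution, integrable_indicator_iff measurableSet_Ioi] at this
  refine this.congr_fun (fun t ht => ?_) measurableSet_Ioi
  simp only [ContinuousLinearMap.mul_apply', _root_.volterraConv]
  rw [← intervalIntegral.integral_const_mul]
  congr 1 with x
  rw [mul_mul_mul_comm, ← Real.exp_add, mul_comm (u x)]
  ring_nf

theorem laplaceTransform_volterraConv {b u : ℝ → ℝ} (hb : LaplaceIntegrable b)
    (hu : LaplaceIntegrable u) {z : ℂ} (hz : 0 < z.re) :
    laplaceTransform (volterraConv b u) z = laplaceTransform b z * laplaceTransform u z := by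
  have := integral_posConvolution (hu.integrableOn_cexp hz) (hb.integrableOn_cexp hz)
    (ContinuousLinearMap.mul ℝ ℂ)
  simp_rw [ContinuousLinearMap.mul_apply'] at this
  rw [laplaceTransform, laplaceTransform, laplaceTransform, mul_comm, ← this]
  refine setIntegral_congr_fun measurableSet_Ioi fun t ht => ?_
  simp only [volterraConv]
  rw [← intervalIntegral.integral_ofReal, ← intervalIntegral.integral_const_mul]
  congr 1 with x
  rw [mul_mul_mul_comm, ← Complex.exp_add]
  push_cast
  ring_nf

/-- The function `e^{-σt} u(t)` on `(0,∞)`, extended by zero. -/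
def damped (σ : ℝ) (u : ℝ → ℝ) : ℝ → ℂ :=
  indicator (Ioi 0) fun t => ((Real.exp (-σ * t) * u t : ℝ) : ℂ)

theorem LaplaceIntegrable.integrable_damped {u : ℝ → ℝ} (hu : LaplaceIntegrable u) {σ : ℝ}
    (hσ : 0 < σ) : Integrable (damped σ u) :=
  (integrable_indicator_iff measurableSet_Ioi).2 (hu σ hσ).ofReal

theorem fourier_damped (u : ℝ → ℝ) (σ ξ : ℝ) :
    𝓕 (damped σ u) ξ = laplaceTransform u (σ + (2 * Real.pi * ξ : ℝ) * Complex.I) := by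
  rw [Real.fourier_real_eq_integral_exp_smul, laplaceTransform, ← integral_indicator measurableSet_Ioi]
  congr 1 with t
  by_cases ht : t ∈ Ioi (0 : ℝ)
  · simp only [damped, indicator_of_mem ht]
    push_cast
    rw [smul_eq_mul, ← mul_assoc, ← Complex.exp_add]
    ring_nf
  · simp only [damped, indicator_of_notMem ht, smul_zero]

theorem LaplaceIntegrable.memLp_damped {u : ℝ → ℝ} (hu : LaplaceIntegrable u) {σ M : ℝ}
    (hσ : 0 < σ) (hM : ∀ t > 0, |Real.exp (-σ * t) * u t| ≤ M) : MemLp (damped σ u) 2 := by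
  have hi := hu.integrable_damped hσ
  rw [memLp_two_iff_integrable_sq_norm hi.aestronglyMeasurable]
  simp_rw [sq]
  refine hi.norm.bdd_mul (c := max M 0) hi.aestronglyMeasurable.norm (Eventually.of_forall fun t => ?_)
  rw [norm_norm]
  by_cases ht : t ∈ Ioi (0 : ℝ)
  · simp only [damped, indicator_of_mem ht, Complex.norm_real]
    exact (hM t ht).trans (le_max_left _ _)
  · simp only [damped, indicator_of_notMem ht, norm_zero]
    exact le_max_right _ _

theorem laplaceIntegrable_of_bdd {u : ℝ → ℝ} {M : ℝ}
    (hm : AEStronglyMeasurable u (volume.restrict (Ioi 0))) (hM : ∀ t > 0, |u t| ≤ M) :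
    LaplaceIntegrable u := fun _ hσ =>
  Integrable.mul_bdd (c := M) (exp_neg_integrableOn_Ioi 0 hσ) hm
    ((ae_restrict_iff' measurableSet_Ioi).2 (Eventually.of_forall fun t ht => hM t ht))

theorem abs_exp_mul_le {u : ℝ → ℝ} {M : ℝ} (hM : ∀ t > 0, |u t| ≤ M) {σ : ℝ} (hσ : 0 < σ) :
    ∀ t > 0, |Real.exp (-σ * t) * u t| ≤ M := by
  intro t ht
  rw [abs_mul, Real.abs_exp]
  refine (mul_le_of_le_one_left (abs_nonneg _) (Real.exp_le_one_iff.2 ?_)).trans (hM t ht)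
  nlinarith

namespace Assumption1

variable {b b' : ℝ → ℝ} {ρ : ℝ}

theorem abs_exp_mul_volterraConv_le (hb : Assumption1 b b' ρ) {u : ℝ → ℝ} {M : ℝ} (hM0 : 0 ≤ M)
    (hM : ∀ t > 0, |u t| ≤ M) {σ : ℝ} (hσ : 0 < σ) {t : ℝ} (ht : 0 < t) :
    |Real.exp (-σ * t) * volterraConv b u t| ≤
      (∫ x in Ioi 0, Real.exp (-σ * x) * b x) * M := by
  have hI := hb.laplaceIntegrable σ hσ
  have hbi : IntervalIntegrable b volume 0 t :=
    (intervalIntegrable_iff_integrableOn_Ioc_of_le ht.le).2 (hb.locInt t ht)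
  have hbi' : IntervalIntegrable (fun x => b (t - x)) volume 0 t := by
    have := (hbi.comp_sub_left t).symm
    simpa using this
  have h1 : |volterraConv b u t| ≤ (∫ x in (0 : ℝ)..t, b x) * M := by
    have e : ∫ x in (0 : ℝ)..t, b (t - x) = ∫ x in (0 : ℝ)..t, b x := by
      rw [intervalIntegral.integral_comp_sub_left]; simp
    rw [← e, ← intervalIntegral.integral_mul_const]
    have h0 : ∀ᵐ x : ℝ, x ≠ t := by simp [ae_iff]
    unfold volterraConv
    rw [← Real.norm_eq_abs]
    refine intervalIntegral.norm_integral_le_of_norm_le ht.le ?_ (hbi'.mul_const M)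
    filter_upwards [h0] with x hx hxm
    have hx' : 0 < t - x := by
      have := lt_of_le_of_ne hxm.2 hx
      linarith
    rw [norm_mul, Real.norm_eq_abs, Real.norm_eq_abs, abs_of_nonneg (hb.nonneg _ hx')]
    exact mul_le_mul_of_nonneg_left (hM x hxm.1) (hb.nonneg _ hx')
  rw [abs_mul, Real.abs_exp]
  refine (mul_le_mul_of_nonneg_left h1 (Real.exp_pos _).le).trans ?_
  rw [← mul_assoc]
  refine mul_le_mul_of_nonneg_right ?_ hM0
  rw [intervalIntegral.integral_of_le ht.le, ← integral_const_mul]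
  refine le_trans (setIntegral_mono_on ((hb.locInt t ht).const_mul _)
    (hI.mono_set Ioc_subset_Ioi_self) measurableSet_Ioc fun x hx => ?_) ?_
  · refine mul_le_mul_of_nonneg_right (Real.exp_le_exp.2 ?_) (hb.nonneg x hx.1)
    nlinarith [hx.2]
  · refine setIntegral_mono_set hI ?_ Ioc_subset_Ioi_self.eventuallyLE
    exact (ae_restrict_iff' measurableSet_Ioi).2 (Eventually.of_forall fun x hx =>
      mul_nonneg (Real.exp_pos _).le (hb.nonneg x hx))

/-- The kernel `b` is of positive type. -/
theorem integral_mul_volterraConv_nonneg (hb : Assumption1 b b' ρ) {u : ℝ → ℝ} {M : ℝ}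
    (hm : AEStronglyMeasurable u (volume.restrict (Ioi 0))) (hM : ∀ t > 0, |u t| ≤ M)
    {σ : ℝ} (hσ : 0 < σ) :
    0 ≤ ∫ t in Ioi 0, (Real.exp (-σ * t) * u t) * (Real.exp (-σ * t) * volterraConv b u t) := by
  have hM0 : 0 ≤ M := (abs_nonneg _).trans (hM 1 one_pos)
  have hu := laplaceIntegrable_of_bdd hm hM
  have hbu := hb.laplaceIntegrable.volterraConv hu
  have hP := integral_conj_mul_fourier (hu.integrable_damped hσ)
    (hu.memLp_damped hσ (abs_exp_mul_le hM hσ)) (hbu.integrable_damped hσ)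
    (hbu.memLp_damped hσ fun t ht => hb.abs_exp_mul_volterraConv_le hM0 hM hσ ht)
  have e1 : ∫ t, (starRingEnd ℂ) (damped σ u t) * damped σ (volterraConv b u) t =
      ((∫ t in Ioi 0, (Real.exp (-σ * t) * u t) *
        (Real.exp (-σ * t) * volterraConv b u t) : ℝ) : ℂ) := by
    rw [← integral_complex_ofReal, ← integral_indicator measurableSet_Ioi]
    congr 1 with t
    by_cases ht : t ∈ Ioi (0 : ℝ)
    · simp only [damped, indicator_of_mem ht, Complex.conj_ofReal]
      push_cast; ring
    · simp only [damped, indicator_of_notMem ht, mul_zero]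
  rw [e1] at hP
  have e2 := congrArg Complex.re hP
  rw [Complex.ofReal_re] at e2
  rw [← e2]
  by_cases hint : Integrable fun ξ =>
    (starRingEnd ℂ) (𝓕 (damped σ u) ξ) * 𝓕 (damped σ (volterraConv b u)) ξ
  · have e3 : (∫ ξ, (starRingEnd ℂ) (𝓕 (damped σ u) ξ) *
        𝓕 (damped σ (volterraConv b u)) ξ).re = ∫ ξ, ((starRingEnd ℂ) (𝓕 (damped σ u) ξ) *
        𝓕 (damped σ (volterraConv b u)) ξ).re := (integral_re hint).symm
    rw [e3]
    refine integral_nonneg fun ξ => ?_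
    have hz : 0 < ((σ : ℂ) + (2 * Real.pi * ξ : ℝ) * Complex.I).re := by simpa using hσ
    simp only [fourier_damped, Pi.zero_apply]
    rw [laplaceTransform_volterraConv hb.laplaceIntegrable hu hz, mul_left_comm, mul_comm (starRingEnd ℂ _),
      Complex.mul_conj, Complex.re_mul_ofReal]
    exact mul_nonneg (hb.re_laplace_pos hz).le (Complex.normSq_nonneg _)
  · rw [integral_undef hint]; simp

end Assumption1

namespace IsScalarSolution

variable {b b' : ℝ → ℝ} {ρ l : ℝ} {s s' : ℝ → ℝ}

theorem sq_le_exp (hs : IsScalarSolution b l s s') (hb : Assumption1 b b' ρ) (hl : 0 < l)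
    {σ T : ℝ} (hσ : 0 < σ) (hT : 0 < T) : Real.exp (-σ * T) ^ 2 * s T ^ 2 ≤ 1 := by
  obtain ⟨M, hM⟩ := (isCompact_Icc (a := (0 : ℝ)) (b := T)).exists_bound_of_continuousOn
    (hs.cont.mono fun _ hx => hx.1)
  have hM0 : 0 ≤ M := (norm_nonneg _).trans (hM 0 ⟨le_rfl, hT.le⟩)
  set u : ℝ → ℝ := indicator (Ioc 0 T) s with hu
  have hm : AEStronglyMeasurable u (volume.restrict (Ioi 0)) :=
    (((hs.cont.mono fun x (hx : x ∈ Icc 0 T) => hx.1).integrableOn_compact isCompact_Icc).mono_set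
      Ioc_subset_Icc_self |>.integrable_indicator measurableSet_Ioc).aestronglyMeasurable.restrict
  have hbd : ∀ t > 0, |u t| ≤ M := by
    intro t ht
    by_cases h : t ∈ Ioc 0 T
    · rw [hu, indicator_of_mem h]; exact hM t ⟨h.1.le, h.2⟩
    · rw [hu, indicator_of_notMem h, abs_zero]; exact hM0
  have hpos := hb.integral_mul_volterraConv_nonneg hm hbd hσ
  have hlu := laplaceIntegrable_of_bdd hm hbd
  have hconv : ∀ t ∈ Ioc 0 T, volterraConv b u t = ∫ x in (0 : ℝ)..t, b (t - x) * s x := by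
    intro t ht
    refine intervalIntegral.integral_congr_ae (Eventually.of_forall fun x hx => ?_)
    rw [uIoc_of_le ht.1.le] at hx
    rw [hu, indicator_of_mem (show x ∈ Ioc 0 T from ⟨hx.1, hx.2.trans ht.2⟩)]
  have hprod : IntegrableOn (fun t => (Real.exp (-σ * t) * u t) *
      (Real.exp (-σ * t) * volterraConv b u t)) (Ioi 0) := by
    refine Integrable.bdd_mul (c := M) (hb.laplaceIntegrable.volterraConv hlu σ hσ)
      (AEStronglyMeasurable.mul (by fun_prop) hm) ?_
    exact (ae_restrict_iff' measurableSet_Ioi).2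
      (Eventually.of_forall fun t ht => abs_exp_mul_le hbd hσ t ht)
  set q : ℝ → ℝ := fun t => Real.exp (-σ * t) ^ 2 * s t ^ 2 with hq
  set q' : ℝ → ℝ := fun t => -2 * σ * (Real.exp (-σ * t) ^ 2 * s t ^ 2) +
    -2 * l * ((Real.exp (-σ * t) * u t) * (Real.exp (-σ * t) * volterraConv b u t)) with hq'
  have hqc : ContinuousOn q (Icc 0 T) := by
    have := hs.cont.mono fun x (hx : x ∈ Icc 0 T) => hx.1
    exact ContinuousOn.mul (by fun_prop) (this.pow 2)
  have hd : ∀ t ∈ Ioo 0 T, HasDerivAt q (q' t) t := by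
    intro t ht
    have h1 := ((((hasDerivAt_id t).const_mul (-σ)).exp).pow 2).mul ((hs.hasDeriv t ht.1).pow 2)
    convert! h1 using 1
    have h2 := hs.eqn t ht.1
    have h3 : s' t = -l * ∫ x in (0 : ℝ)..t, b (t - x) * s x := by linarith
    have hut : u t = s t := indicator_of_mem (show t ∈ Ioc 0 T from ⟨ht.1, ht.2.le⟩) s
    simp only [hq', hconv t ⟨ht.1, ht.2.le⟩, hut]
    rw [h3]
    simp
    ring
  have hqi : IntegrableOn q (Ioc 0 T) :=
    (hqc.integrableOn_compact isCompact_Icc).mono_set Ioc_subset_Icc_self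
  have hpi : IntegrableOn (fun t => (Real.exp (-σ * t) * u t) *
      (Real.exp (-σ * t) * volterraConv b u t)) (Ioc 0 T) := hprod.mono_set Ioc_subset_Ioi_self
  have hqi' : IntegrableOn q' (Ioc 0 T) := (hqi.const_mul (-2 * σ)).add (hpi.const_mul (-2 * l))
  have ftc := intervalIntegral.integral_eq_sub_of_hasDerivAt_of_le hT.le hqc hd
    ((intervalIntegrable_iff_integrableOn_Ioc_of_le hT.le).2 hqi')
  rw [intervalIntegral.integral_of_le hT.le, hq',
    integral_add (hqi.const_mul (-2 * σ)) (hpi.const_mul (-2 * l)), integral_const_mul,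
    integral_const_mul] at ftc
  have e1 : 0 ≤ ∫ t in Ioc 0 T, q t := integral_nonneg fun t => by positivity
  have e2 : ∫ t in Ioi 0, (Real.exp (-σ * t) * u t) * (Real.exp (-σ * t) * volterraConv b u t) =
      ∫ t in Ioc 0 T, (Real.exp (-σ * t) * u t) * (Real.exp (-σ * t) * volterraConv b u t) := by
    refine (setIntegral_eq_of_subset_of_forall_sdiff_eq_zero measurableSet_Ioi Ioc_subset_Ioi_self
      fun t ht => ?_)
    rw [hu, indicator_of_notMem ht.2]; simp
  rw [e2] at hpos
  have hq0 : q 0 = 1 := by simp [hq, hs.init]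
  have : q T ≤ 1 := by
    have := mul_nonneg hσ.le e1
    have := mul_nonneg hl.le hpos
    rw [hq0] at ftc
    linarith
  exact this

theorem abs_le_one (hs : IsScalarSolution b l s s') (hb : Assumption1 b b' ρ) (hl : 0 < l)
    {t : ℝ} (ht : 0 < t) : |s t| ≤ 1 := by
  rw [← sq_le_one_iff_abs_le_one]
  have hlim : Tendsto (fun σ : ℝ => Real.exp (-σ * t) ^ 2 * s t ^ 2) (nhdsWithin 0 (Ioi 0))
      (nhds (Real.exp (-0 * t) ^ 2 * s t ^ 2)) :=
    (Continuous.tendsto (by fun_prop) 0).mono_left nhdsWithin_le_nhds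
  refine le_of_eq_of_le (by simp) (le_of_tendsto hlim ?_)
  filter_upwards [self_mem_nhdsWithin] with σ hσ
  exact hs.sq_le_exp hb hl hσ ht

theorem aestronglyMeasurable (hs : IsScalarSolution b l s s') :
    AEStronglyMeasurable s (volume.restrict (Ioi 0)) :=
  (hs.cont.mono Ioi_subset_Ici_self).aestronglyMeasurable measurableSet_Ioi

theorem laplaceIntegrable (hs : IsScalarSolution b l s s') (hb : Assumption1 b b' ρ) (hl : 0 < l) :
    LaplaceIntegrable s :=
  laplaceIntegrable_of_bdd hs.aestronglyMeasurable fun _ ht => hs.abs_le_one hb hl ht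

theorem memLp_damped (hs : IsScalarSolution b l s s') (hb : Assumption1 b b' ρ) (hl : 0 < l)
    {σ : ℝ} (hσ : 0 < σ) : MemLp (damped σ s) 2 :=
  (hs.laplaceIntegrable hb hl).memLp_damped hσ
    (abs_exp_mul_le (fun _ ht => hs.abs_le_one hb hl ht) hσ)

theorem laplaceTransform_eq (hs : IsScalarSolution b l s s') (hb : Assumption1 b b' ρ)
    (hl : 0 < l) {z : ℂ} (hz : 0 < z.re) :
    laplaceTransform s z = (z + l * laplaceTransform b z)⁻¹ := by
  have hL := hs.laplaceIntegrable hb hl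
  have hC := hb.laplaceIntegrable.volterraConv hL
  have hd : ∀ t ∈ Ioi (0 : ℝ), HasDerivAt (fun t : ℝ => Complex.exp (-z * t) * (s t : ℂ))
      (-z * (Complex.exp (-z * t) * (s t : ℂ)) +
        -l * (Complex.exp (-z * t) * (volterraConv b s t : ℂ))) t := by
    intro t ht
    have h1 := (((Complex.ofRealCLM.hasDerivAt (x := t)).const_mul (-z)).cexp).mul
      (hs.hasDeriv t ht).ofReal_comp
    convert! h1 using 1
    have h2 := hs.eqn t ht
    have h3 : s' t = -l * volterraConv b s t := by unfold volterraConv; linarith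
    rw [h3]
    simp
    ring
  have hi1 := (hL.integrableOn_cexp hz).const_mul (-z)
  have hi2 := (hC.integrableOn_cexp hz).const_mul (-(l : ℂ))
  have htend : Tendsto (fun t : ℝ => Complex.exp (-z * t) * (s t : ℂ)) atTop (nhds 0) := by
    rw [tendsto_zero_iff_norm_tendsto_zero]
    have h0 : Tendsto (fun t : ℝ => Real.exp (-(z.re * t))) atTop (nhds 0) :=
      Real.tendsto_exp_neg_atTop_nhds_zero.comp (tendsto_id.const_mul_atTop hz)
    refine squeeze_zero' (Eventually.of_forall fun _ => norm_nonneg _) ?_ h0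
    filter_upwards [eventually_gt_atTop 0] with t ht
    rw [norm_mul, Complex.norm_exp, Complex.norm_real, Real.norm_eq_abs]
    have e : (-z * t).re = -(z.re * t) := by simp
    rw [e]
    exact mul_le_of_le_one_right (Real.exp_pos _).le (hs.abs_le_one hb hl ht)
  have hc0 : ContinuousWithinAt (fun t : ℝ => Complex.exp (-z * t) * (s t : ℂ)) (Ici 0) 0 := by
    refine ContinuousWithinAt.mul (by fun_prop) ?_
    exact (Complex.continuous_ofReal.continuousAt).comp_continuousWithinAt (hs.cont 0 self_mem_Ici)
  have key := integral_Ioi_of_hasDerivAt_of_tendsto hc0 hd (hi1.add hi2) htend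
  rw [integral_add hi1 hi2, integral_const_mul, integral_const_mul] at key
  change -z * laplaceTransform s z + -l * laplaceTransform (volterraConv b s) z = _ at key
  rw [laplaceTransform_volterraConv hb.laplaceIntegrable hL hz, hs.init] at key
  refine eq_inv_of_mul_eq_one_left ?_
  simp at key
  linear_combination -key

end IsScalarSolution

end FourierHelpers

section FourierHelpers

open scoped FourierTransform ContDiff

theorem norm_sum_smul_sq {H ι : Type*} [NormedAddCommGroup H] [InnerProductSpace ℝ H] [Fintype ι]
    (a : ι → ℝ) (v : ι → H) :
    ‖∑ i, a i • v i‖ ^ 2 = ∑ i, ∑ j, (a i * a j) * ⟪v i, v j⟫ := by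
  rw [← real_inner_self_eq_norm_sq, sum_inner]
  simp_rw [inner_sum, real_inner_smul_left, real_inner_smul_right, mul_assoc]

theorem re_conj_mul (z w : ℂ) : ((starRingEnd ℂ) z * w).re = z.re * w.re + z.im * w.im := by
  simp

/-- Plancherel's theorem for finite combinations of damped scalar functions. -/
theorem lintegral_damped_sum_eq {H ι : Type*} [NormedAddCommGroup H] [InnerProductSpace ℝ H]
    [Fintype ι] {σ : ℝ} {u : ι → ℝ → ℝ} (h1 : ∀ i, Integrable (damped σ (u i)))
    (h2 : ∀ i, MemLp (damped σ (u i)) 2) (v : ι → H) :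
    ∫⁻ t in Ioi 0, ENNReal.ofReal (‖∑ i, (Real.exp (-σ * t) * u i t) • v i‖ ^ 2) =
      ∫⁻ ξ, ENNReal.ofReal (‖∑ i, (𝓕 (damped σ (u i)) ξ).re • v i‖ ^ 2 +
        ‖∑ i, (𝓕 (damped σ (u i)) ξ).im • v i‖ ^ 2) := by
  have hF : ∀ i, MemLp (𝓕 (damped σ (u i))) 2 := fun i => memLp_fourier (h1 i) (h2 i)
  have hint : ∀ {f g : ℝ → ℂ}, MemLp f 2 → MemLp g 2 →
      Integrable fun x => (starRingEnd ℂ) (f x) * g x := fun hf hg =>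
    MemLp.integrable_mul hf.star hg
  have i1 : ∀ i j, Integrable fun t =>
      ((starRingEnd ℂ) (damped σ (u i) t) * damped σ (u j) t).re * ⟪v i, v j⟫ := fun i j =>
    (hint (h2 i) (h2 j)).re.mul_const _
  have i2 : ∀ i j, Integrable fun ξ =>
      ((starRingEnd ℂ) (𝓕 (damped σ (u i)) ξ) * 𝓕 (damped σ (u j)) ξ).re * ⟪v i, v j⟫ := fun i j =>
    (hint (hF i) (hF j)).re.mul_const _
  have e1 : ∀ w : ι → ℂ, ‖∑ i, (w i).re • v i‖ ^ 2 + ‖∑ i, (w i).im • v i‖ ^ 2 =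
      ∑ i, ∑ j, ((starRingEnd ℂ) (w i) * w j).re * ⟪v i, v j⟫ := by
    intro w
    rw [norm_sum_smul_sq, norm_sum_smul_sq, ← Finset.sum_add_distrib]
    refine Finset.sum_congr rfl fun i _ => ?_
    rw [← Finset.sum_add_distrib]
    refine Finset.sum_congr rfl fun j _ => ?_
    rw [re_conj_mul]; ring
  have e2 : ∫⁻ t in Ioi 0, ENNReal.ofReal (‖∑ i, (Real.exp (-σ * t) * u i t) • v i‖ ^ 2) =
      ∫⁻ t, ENNReal.ofReal (∑ i, ∑ j,
        ((starRingEnd ℂ) (damped σ (u i) t) * damped σ (u j) t).re * ⟪v i, v j⟫) := by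
    rw [← lintegral_indicator measurableSet_Ioi]
    congr 1 with t
    rw [← e1]
    by_cases ht : t ∈ Ioi (0 : ℝ)
    · simp only [damped, indicator_of_mem ht, Complex.ofReal_re, Complex.ofReal_im, zero_smul,
        Finset.sum_const_zero, norm_zero, zero_pow two_ne_zero, add_zero]
    · simp [damped, indicator_of_notMem ht]
  simp_rw [e1]
  rw [e2, ← ofReal_integral_eq_lintegral_ofReal, ← ofReal_integral_eq_lintegral_ofReal]
  · congr 1
    rw [integral_finsetSum _ fun i _ => integrable_finsetSum _ fun j _ => i1 i j,
      integral_finsetSum _ fun i _ => integrable_finsetSum _ fun j _ => i2 i j]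
    refine Finset.sum_congr rfl fun i _ => ?_
    rw [integral_finsetSum _ fun j _ => i1 i j, integral_finsetSum _ fun j _ => i2 i j]
    refine Finset.sum_congr rfl fun j _ => ?_
    rw [integral_mul_const, integral_mul_const]
    congr 1
    have hP := congrArg Complex.re (integral_conj_mul_fourier (h1 i) (h2 i) (h1 j) (h2 j))
    have r1 := integral_re (hint (h2 i) (h2 j))
    have r2 := integral_re (hint (hF i) (hF j))
    simp only [RCLike.re_to_complex] at r1 r2
    rw [r1, r2]
    exact hP.symm
  · exact integrable_finsetSum _ fun i _ => integrable_finsetSum _ fun j _ => i2 i j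
  · refine Eventually.of_forall fun ξ => ?_
    simp only [Pi.zero_apply]
    rw [← e1]; positivity
  · exact integrable_finsetSum _ fun i _ => integrable_finsetSum _ fun j _ => i1 i j
  · refine Eventually.of_forall fun ξ => ?_
    simp only [Pi.zero_apply]
    rw [← e1 (fun i => damped σ (u i) ξ)]; positivity

theorem lintegral_inv_sq_add_sq {L : ℝ} (hL : 0 < L) :
    ∫⁻ ξ : ℝ, ENNReal.ofReal (((2 * Real.pi * ξ) ^ 2 + L ^ 2)⁻¹) = ENNReal.ofReal (1 / 2 * L⁻¹) := by
  have hpi := Real.pi_pos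
  have e : ∀ ξ : ℝ, ((2 * Real.pi * ξ) ^ 2 + L ^ 2)⁻¹ =
      (L ^ 2)⁻¹ * (1 + ((2 * Real.pi / L) * ξ) ^ 2)⁻¹ := by
    intro ξ
    rw [← mul_inv]
    congr 1
    field_simp
    ring
  simp_rw [e]
  have hi : Integrable fun ξ : ℝ => (L ^ 2)⁻¹ * (1 + ((2 * Real.pi / L) * ξ) ^ 2)⁻¹ :=
    ((integrable_inv_one_add_sq.comp_mul_left' (by positivity))).const_mul _
  rw [← ofReal_integral_eq_lintegral_ofReal hi (Eventually.of_forall fun ξ => by positivity)]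
  congr 1
  rw [integral_const_mul, Measure.integral_comp_mul_left (fun x : ℝ => (1 + x ^ 2)⁻¹),
    integral_univ_inv_one_add_sq, abs_of_pos (by positivity), smul_eq_mul]
  field_simp

namespace Assumption1

variable {b b' : ℝ → ℝ} {ρ : ℝ}

theorem exists_norm_inv_sq_le (hb : Assumption1 b b' ρ) {l₀ : ℝ} (hl₀ : 0 < l₀) :
    ∃ K > 0, ∀ l, l₀ ≤ l → ∀ z : ℂ, 0 < z.re → z.re ≤ 1 → z.im ≠ 0 →
      ‖(z + l * laplaceTransform b z)⁻¹‖ ^ 2 ≤ K * (z.im ^ 2 + (l ^ (1 / ρ)) ^ 2)⁻¹ := by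
  obtain ⟨c, hc, hcb⟩ := hb.exists_le_norm_laplace
  have hκ := hb.cos_angle_pos
  have hn := @norm_add_le b b' ρ hb
  set D := 1 + 2 / Real.cos ((ρ - 1) * (Real.pi / 2)) with hD
  have hD0 : 0 < D := by positivity
  have hρ1 := hb.rho_mem.1
  have hρ0 : 0 < ρ := by linarith
  set a := min 1 ((l₀ ^ (1 / ρ)) ^ (ρ - 1)) with ha
  have ha0 : 0 < a := by positivity
  have ha1 : a ≤ 1 := min_le_left _ _
  set c₂ := min 1 c * a / D with hc₂
  have hc₂0 : 0 < c₂ := by positivity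
  refine ⟨2 / c₂ ^ 2, by positivity, fun l hl z hz hz1 hi => ?_⟩
  have hl0 : 0 < l := hl₀.trans_le hl
  set L := l ^ (1 / ρ) with hL
  have hL0 : 0 < L := by positivity
  have hlL : l = L * L ^ (ρ - 1) := by
    rw [hL, ← Real.rpow_mul hl0.le, ← Real.rpow_add hl0]
    have : 1 / ρ + 1 / ρ * (ρ - 1) = 1 := by field_simp; ring
    rw [this, Real.rpow_one]
  have hw : 0 < |z.im| := abs_pos.2 hi
  have h1 := hn hz hl0
  have h2 := hcb z hz hz1 hi
  have h3 : |z.im| ≤ ‖z‖ := Complex.abs_im_le_norm z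
  have h4 : a * max |z.im| L ≤ |z.im| + l * max 1 |z.im| ^ (1 - ρ) := by
    have hpos : 0 < l * max 1 |z.im| ^ (1 - ρ) := by positivity
    rcases le_total L |z.im| with h | h
    · rw [max_eq_left h]
      nlinarith
    · rw [max_eq_right h]
      have : a * L ≤ l * max 1 |z.im| ^ (1 - ρ) := by
        rw [hlL, mul_comm a, mul_assoc]
        refine mul_le_mul_of_nonneg_left ?_ hL0.le
        rcases le_total |z.im| 1 with h5 | h5
        · rw [max_eq_left h5, Real.one_rpow, mul_one]
          refine (min_le_right _ _).trans ?_
          exact Real.rpow_le_rpow (by positivity)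
            (Real.rpow_le_rpow hl₀.le hl (by positivity)) (by linarith)
        · rw [max_eq_right h5]
          refine ha1.trans ?_
          have e : |z.im| ^ (1 - ρ) = (|z.im| ^ (ρ - 1))⁻¹ := by
            rw [← Real.rpow_neg hw.le]; ring_nf
          rw [e, ← div_eq_mul_inv, one_le_div (by positivity)]
          exact Real.rpow_le_rpow hw.le h (by linarith)
      linarith
  have h5 : c₂ * max |z.im| L ≤ ‖z + l * laplaceTransform b z‖ := by
    have e1 : min 1 c * (|z.im| + l * max 1 |z.im| ^ (1 - ρ)) ≤
        ‖z‖ + l * ‖laplaceTransform b z‖ := by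
      have hm1 : min 1 c ≤ 1 := min_le_left _ _
      have hm2 : min 1 c ≤ c := min_le_right _ _
      have hp : 0 < max 1 |z.im| ^ (1 - ρ) := by positivity
      have e2 : min 1 c * max 1 |z.im| ^ (1 - ρ) ≤ ‖laplaceTransform b z‖ :=
        (mul_le_mul_of_nonneg_right hm2 hp.le).trans h2
      have e3 := mul_le_mul_of_nonneg_left e2 hl0.le
      have e4 := mul_le_mul_of_nonneg_right hm1 hw.le
      linarith
    have e2 := mul_le_mul_of_nonneg_left h4 (show 0 ≤ min 1 c by positivity)
    rw [hc₂, div_mul_eq_mul_div, div_le_iff₀ hD0]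
    linarith
  have h6 : z.im ^ 2 + L ^ 2 ≤ 2 * max |z.im| L ^ 2 := by
    have q1 : |z.im| ^ 2 ≤ max |z.im| L ^ 2 := pow_le_pow_left₀ hw.le (le_max_left _ _) 2
    have q2 : L ^ 2 ≤ max |z.im| L ^ 2 := pow_le_pow_left₀ hL0.le (le_max_right _ _) 2
    rw [sq_abs] at q1
    linarith
  have h7 : (c₂ * max |z.im| L) ^ 2 ≤ ‖z + l * laplaceTransform b z‖ ^ 2 :=
    pow_le_pow_left₀ (by positivity) h5 2
  rw [norm_inv, inv_pow, ← div_eq_mul_inv, inv_le_comm₀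
    (pow_pos (norm_pos_iff.2 (hb.add_mul_laplace_ne_zero hz hl0)) 2) (by positivity), inv_div,
    div_le_iff₀ (by positivity)]
  rw [mul_pow] at h7
  calc z.im ^ 2 + L ^ 2 ≤ 2 * max |z.im| L ^ 2 := h6
    _ = c₂ ^ 2 * max |z.im| L ^ 2 * (2 / c₂ ^ 2) := by field_simp
    _ ≤ _ := mul_le_mul_of_nonneg_right h7 (by positivity)

/-- Time-domain `L²` bounds from frequency-domain bounds, for finite combinations of scalar
solutions. -/
theorem exists_lintegral_le (hb : Assumption1 b b' ρ) {l₀ : ℝ} (hl₀ : 0 < l₀)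
    (H : Type*) [NormedAddCommGroup H] [InnerProductSpace ℝ H] :
    ∃ C > 0, ∀ (ι κ : Type) [Fintype ι] [Fintype κ] (l : ι → ℝ) (u u' : ι → ℝ → ℝ) (v : ι → H)
      (τ w : κ → ℝ) (A : ℝ), 0 ≤ A → (∀ i, 0 < l i) →
      (∀ i, IsScalarSolution b (l i) (u i) (u' i)) → (∀ m, l₀ ≤ τ m) → (∀ m, 0 ≤ w m) →
      (∀ z : ℂ, 0 < z.re → ‖∑ i, ((z + l i * laplaceTransform b z)⁻¹).re • v i‖ ^ 2 +
        ‖∑ i, ((z + l i * laplaceTransform b z)⁻¹).im • v i‖ ^ 2 ≤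
          A * ∑ m, w m * ‖(z + τ m * laplaceTransform b z)⁻¹‖ ^ 2) →
      ∀ t > 0, ∫⁻ x in Ioc 0 t, ENNReal.ofReal (‖∑ i, u i x • v i‖ ^ 2) ≤
        ENNReal.ofReal (C * A * ∑ m, w m * τ m ^ (-(1 / ρ))) := by
  obtain ⟨K, hK, hKb⟩ := hb.exists_norm_inv_sq_le hl₀
  refine ⟨Real.exp 2 * K, by positivity, ?_⟩
  intro ι κ _ _ l u u' v τ w A hA hl hu hτ hw hz t ht
  set σ : ℝ := 1 / (1 + t) with hσdef
  have hσ : 0 < σ := by positivity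
  have hσ1 : σ ≤ 1 := by rw [hσdef, div_le_one (by positivity)]; linarith
  have hσt : σ * t ≤ 1 := by
    rw [hσdef, one_div_mul_eq_div, div_le_one (by positivity)]; linarith
  have hlap := fun i => (hu i).laplaceIntegrable hb (hl i)
  have hP := lintegral_damped_sum_eq (fun i => (hlap i).integrable_damped hσ)
    (fun i => (hu i).memLp_damped hb (hl i) hσ) v
  have hτ0 : ∀ m, 0 < τ m := fun m => hl₀.trans_le (hτ m)
  have step1 : ∫⁻ x in Ioc 0 t, ENNReal.ofReal (‖∑ i, u i x • v i‖ ^ 2) ≤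
      ENNReal.ofReal (Real.exp 2) *
        ∫⁻ x in Ioi 0, ENNReal.ofReal (‖∑ i, (Real.exp (-σ * x) * u i x) • v i‖ ^ 2) := by
    rw [← lintegral_const_mul' _ _ ENNReal.ofReal_ne_top]
    refine le_trans (setLIntegral_mono' measurableSet_Ioc fun x hx => ?_)
      (lintegral_mono_set Ioc_subset_Ioi_self)
    rw [← ENNReal.ofReal_mul (Real.exp_pos _).le]
    refine ENNReal.ofReal_le_ofReal ?_
    simp_rw [mul_smul, ← Finset.smul_sum]
    rw [norm_smul, mul_pow, ← mul_assoc, Real.norm_eq_abs, Real.abs_exp]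
    refine le_mul_of_one_le_left (by positivity) ?_
    rw [← Real.exp_nat_mul, ← Real.exp_add, Real.one_le_exp_iff]
    have : σ * x ≤ σ * t := mul_le_mul_of_nonneg_left hx.2 hσ.le
    push_cast
    linarith
  have step2 : ∫⁻ x in Ioi 0, ENNReal.ofReal (‖∑ i, (Real.exp (-σ * x) * u i x) • v i‖ ^ 2) ≤
      ∫⁻ ξ : ℝ, ∑ m, ENNReal.ofReal (A * w m * K) *
        ENNReal.ofReal (((2 * Real.pi * ξ) ^ 2 + (τ m ^ (1 / ρ)) ^ 2)⁻¹) := by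
    rw [hP]
    have h0 : ∀ᵐ ξ : ℝ, ξ ≠ 0 := by simp [ae_iff]
    refine lintegral_mono_ae ?_
    filter_upwards [h0] with ξ hξ
    simp_rw [fourier_damped]
    set z : ℂ := σ + (2 * Real.pi * ξ : ℝ) * Complex.I with hzdef
    have hre : z.re = σ := by simp [hzdef]
    have him : z.im = 2 * Real.pi * ξ := by simp [hzdef]
    have hz0 : 0 < z.re := by rw [hre]; exact hσ
    have hzi : z.im ≠ 0 := by
      rw [him]; exact mul_ne_zero (by positivity) hξ
    simp_rw [fun i => (hu i).laplaceTransform_eq hb (hl i) hz0]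
    rw [Finset.sum_congr rfl fun m _ => (ENNReal.ofReal_mul
      (mul_nonneg (mul_nonneg hA (hw m)) hK.le)).symm, ← ENNReal.ofReal_sum_of_nonneg
      fun m _ => mul_nonneg (mul_nonneg (mul_nonneg hA (hw m)) hK.le) (by positivity)]
    refine ENNReal.ofReal_le_ofReal ((hz z hz0).trans ?_)
    rw [Finset.mul_sum]
    refine Finset.sum_le_sum fun m _ => ?_
    have := hKb (τ m) (hτ m) z hz0 (by rw [hre]; exact hσ1) hzi
    rw [him] at this
    calc A * (w m * ‖(z + τ m * laplaceTransform b z)⁻¹‖ ^ 2) =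
        A * w m * ‖(z + τ m * laplaceTransform b z)⁻¹‖ ^ 2 := by ring
      _ ≤ A * w m * (K * ((2 * Real.pi * ξ) ^ 2 + (τ m ^ (1 / ρ)) ^ 2)⁻¹) :=
        mul_le_mul_of_nonneg_left this (mul_nonneg hA (hw m))
      _ = _ := by ring
  have step3 : ∫⁻ ξ : ℝ, ∑ m, ENNReal.ofReal (A * w m * K) *
        ENNReal.ofReal (((2 * Real.pi * ξ) ^ 2 + (τ m ^ (1 / ρ)) ^ 2)⁻¹) ≤
      ENNReal.ofReal (K * A * ∑ m, w m * τ m ^ (-(1 / ρ))) := by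
    rw [lintegral_finsetSum' _ fun m _ => by fun_prop, Finset.mul_sum,
      ENNReal.ofReal_sum_of_nonneg fun m _ => by
        have := hw m; have := hτ0 m; positivity]
    refine Finset.sum_le_sum fun m _ => ?_
    have h1 := hw m
    have h2 := hτ0 m
    rw [lintegral_const_mul' _ _ ENNReal.ofReal_ne_top,
      lintegral_inv_sq_add_sq (Real.rpow_pos_of_pos h2 _),
      ← ENNReal.ofReal_mul (by positivity), ← Real.rpow_neg h2.le]
    refine ENNReal.ofReal_le_ofReal ?_
    have : 0 ≤ A * w m * K * τ m ^ (-(1 / ρ)) := by positivity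
    linarith
  refine step1.trans ((mul_le_mul_right (step2.trans step3) _).trans ?_)
  rw [← ENNReal.ofReal_mul (Real.exp_pos _).le]
  refine ENNReal.ofReal_le_ofReal (le_of_eq (by ring))

end Assumption1

end FourierHelpers

section Galerkin

variable {H : Type*} [NormedAddCommGroup H] [InnerProductSpace ℝ H]

theorem HilbertBasis.inner_sum_smul (e : HilbertBasis ℕ ℝ H) (F : Finset ℕ) (c : ℕ → ℝ) (m : ℕ) :
    ⟪∑ k ∈ F, c k • (e k : H), e m⟫ = if m ∈ F then c m else 0 := by
  simp_rw [sum_inner, real_inner_smul_left, orthonormal_iff_ite.1 e.orthonormal]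
  simp

theorem HilbertBasis.hasSum_inner_sq (e : HilbertBasis ℕ ℝ H) (x : H) :
    HasSum (fun k => ⟪x, e k⟫ ^ 2) (‖x‖ ^ 2) := by
  rw [← real_inner_self_eq_norm_sq]
  have h := e.hasSum_inner_mul_inner x x
  simp_rw [real_inner_comm x, ← sq] at h
  exact h

theorem Orthonormal.inner_sum_smul {ι : Type*} [Fintype ι] {f : ι → H} (hf : Orthonormal ℝ f)
    (q : ι → ℝ) (j : ι) : ⟪∑ i, q i • f i, f j⟫ = q j := by
  classical
  simp_rw [sum_inner, real_inner_smul_left, orthonormal_iff_ite.1 hf]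
  simp

theorem Orthonormal.norm_sum_smul_sq {ι : Type*} [Fintype ι] {f : ι → H} (hf : Orthonormal ℝ f)
    (q : ι → ℝ) : ‖∑ i, q i • f i‖ ^ 2 = ∑ i, q i ^ 2 := by
  rw [← real_inner_self_eq_norm_sq, inner_sum]
  refine Finset.sum_congr rfl fun j _ => ?_
  rw [real_inner_smul_right, hf.inner_sum_smul, sq]

theorem Orthonormal.sum_inner_smul_eq {ι : Type*} [Fintype ι] {f : ι → H} (hf : Orthonormal ℝ f)
    {v : H} (hv : v ∈ Submodule.span ℝ (range f)) : ∑ i, ⟪v, f i⟫ • f i = v := by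
  obtain ⟨q, rfl⟩ := (Submodule.mem_span_range_iff_exists_fun ℝ).1 hv
  simp_rw [hf.inner_sum_smul]

namespace FESetup

variable {e : HilbertBasis ℕ ℝ H} {lam : ℕ → ℝ} {N : ℕ} {f : Fin N → H} {μ : Fin N → ℝ}

theorem summable_sq (hf : FESetup e lam N f μ) (hlam : ∀ k, 0 < lam k) (j : Fin N) :
    Summable fun k => lam k * ⟪f j, e k⟫ ^ 2 := by
  refine (ENNReal.summable_toReal (hf.f_dom j).ne).congr fun k => ?_
  exact ENNReal.toReal_ofReal (mul_nonneg (hlam k).le (sq_nonneg _))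

theorem hasSum_basis (hf : FESetup e lam N f μ) (hlam : ∀ k, 0 < lam k) (i j : Fin N) :
    HasSum (fun k => lam k * ⟪f i, e k⟫ * ⟪f j, e k⟫) (μ i * ⟪f i, f j⟫) := by
  rw [← hf.eigen]
  refine Summable.hasSum (((hf.summable_sq hlam i).add (hf.summable_sq hlam j)).of_norm_bounded
    fun k => ?_)
  rw [Real.norm_eq_abs, mul_assoc, abs_mul, abs_of_pos (hlam k), ← mul_add]
  refine mul_le_mul_of_nonneg_left ?_ (hlam k).le
  rw [abs_le]
  constructor <;> nlinarith [sq_nonneg (⟪f i, e k⟫ + ⟪f j, e k⟫),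
    sq_nonneg (⟪f i, e k⟫ - ⟪f j, e k⟫), sq_nonneg ⟪f i, e k⟫, sq_nonneg ⟪f j, e k⟫]

theorem hasSum_sum_smul (hf : FESetup e lam N f μ) (hlam : ∀ k, 0 < lam k) (q : Fin N → ℝ)
    (j : Fin N) :
    HasSum (fun k => lam k * ⟪∑ i, q i • f i, e k⟫ * ⟪f j, e k⟫) (μ j * q j) := by
  have h := hasSum_sum (s := Finset.univ) fun i _ => (hf.hasSum_basis hlam i j).mul_left (q i)
  convert! h using 1
  · ext k
    rw [sum_inner, Finset.mul_sum, Finset.sum_mul]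
    refine Finset.sum_congr rfl fun i _ => ?_
    rw [real_inner_smul_left]; ring
  · simp_rw [orthonormal_iff_ite.1 hf.f_orth]
    simp [mul_comm]

theorem hasSum_energy (hf : FESetup e lam N f μ) (hlam : ∀ k, 0 < lam k) (q : Fin N → ℝ) :
    HasSum (fun k => lam k * ⟪∑ i, q i • f i, e k⟫ ^ 2) (∑ j, μ j * q j ^ 2) := by
  have h := hasSum_sum (s := Finset.univ) fun j _ => (hf.hasSum_sum_smul hlam q j).mul_left (q j)
  convert! h using 1
  · ext k
    have : ⟪∑ i, q i • f i, e k⟫ = ∑ j, q j * ⟪f j, e k⟫ := by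
      rw [sum_inner]; simp_rw [real_inner_smul_left]
    rw [sq, ← mul_assoc]
    nth_rewrite 2 [this]
    rw [Finset.mul_sum]
    exact Finset.sum_congr rfl fun j _ => by ring
  · exact Finset.sum_congr rfl fun j _ => by ring

theorem le_eigenvalue (hf : FESetup e lam N f μ) (hlam : ∀ k, 0 < lam k) (hmono : Monotone lam)
    (j : Fin N) : lam 0 ≤ μ j := by
  have h1 := hf.hasSum_basis hlam j j
  have h2 := (e.hasSum_inner_sq (f j)).mul_left (lam 0)
  rw [real_inner_self_eq_norm_sq, hf.f_orth.1 j] at h1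
  rw [hf.f_orth.1 j] at h2
  have := hasSum_le (fun k => ?_) h2 h1
  · simpa using this
  · rw [mul_assoc, ← sq]
    exact mul_le_mul_of_nonneg_right (hmono (Nat.zero_le k)) (sq_nonneg _)

/-- The Galerkin identity behind the Ritz projection, for a finite eigenfunction expansion. -/
theorem sum_eq_mul_inner_ritz (hf : FESetup e lam N f μ) (hlam : ∀ k, 0 < lam k) {Rh : H → H}
    (hR : ∀ v : H, Rh v ∈ Submodule.span ℝ (range f))
    (hG : ∀ v : H, (∑' k, ENNReal.ofReal (lam k * ⟪v, e k⟫ ^ 2)) < ⊤ →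
      ∀ j, (∑' k, lam k * ⟪Rh v - v, e k⟫ * ⟪f j, e k⟫) = 0)
    (F : Finset ℕ) (d : ℕ → ℝ) (j : Fin N) :
    ∑ k ∈ F, lam k * d k * ⟪f j, e k⟫ = μ j * ⟪Rh (∑ k ∈ F, d k • (e k : H)), f j⟫ := by
  set y : H := ∑ k ∈ F, d k • (e k : H) with hy
  have hyk : ∀ m, ⟪y, e m⟫ = if m ∈ F then d m else 0 := e.inner_sum_smul F d
  have hfin : (∑' k, ENNReal.ofReal (lam k * ⟪y, e k⟫ ^ 2)) < ⊤ := by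
    rw [tsum_eq_sum (s := F) fun k hk => by simp [hyk, hk]]
    exact ENNReal.sum_lt_top.2 fun _ _ => ENNReal.ofReal_lt_top
  have h1 := hf.hasSum_sum_smul hlam (fun i => ⟪Rh y, f i⟫) j
  rw [hf.f_orth.sum_inner_smul_eq (hR y)] at h1
  have h2 : HasSum (fun k => lam k * ⟪y, e k⟫ * ⟪f j, e k⟫)
      (∑ k ∈ F, lam k * ⟪y, e k⟫ * ⟪f j, e k⟫) :=
    hasSum_sum_of_ne_finset_zero fun k hk => by simp [hyk, hk]
  have h3 := h1.sub h2
  have h4 := hG y hfin j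
  have h5 : (fun k => lam k * ⟪Rh y - y, e k⟫ * ⟪f j, e k⟫) = fun k =>
      lam k * ⟪Rh y, e k⟫ * ⟪f j, e k⟫ - lam k * ⟪y, e k⟫ * ⟪f j, e k⟫ := by
    ext k; rw [inner_sub_left]; ring
  rw [h5, h3.tsum_eq, sub_eq_zero] at h4
  rw [h4]
  exact Finset.sum_congr rfl fun k hk => by simp [hyk, hk]

theorem sum_inner_sq_div_add_le (hf : FESetup e lam N f μ) (hlam : ∀ k, 0 < lam k)
    (F : Finset ℕ) (c : ℕ → ℝ) {τ : ℝ} (hτ : 0 ≤ τ) :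
    ∑ j, ⟪∑ k ∈ F, c k • (e k : H), f j⟫ ^ 2 / (μ j + τ) ≤ ∑ k ∈ F, c k ^ 2 / (lam k + τ) := by
  set x : H := ∑ k ∈ F, c k • (e k : H) with hx
  have hμ : ∀ j, 0 < μ j + τ := fun j => by linarith [hf.mu_pos j]
  have hl : ∀ k, 0 < lam k + τ := fun k => by linarith [hlam k]
  set q : Fin N → ℝ := fun j => ⟪x, f j⟫ / (μ j + τ) with hq
  set v : H := ∑ j, q j • f j with hv
  set S := ∑ j, ⟪x, f j⟫ ^ 2 / (μ j + τ) with hS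
  set T := ∑ k ∈ F, c k ^ 2 / (lam k + τ) with hT
  have hSv : S = ∑ k ∈ F, c k * ⟪v, e k⟫ := by
    have h1 : ⟪x, v⟫ = S := by
      rw [hv, inner_sum]
      refine Finset.sum_congr rfl fun j _ => ?_
      rw [real_inner_smul_right, hq]; ring
    rw [← h1, hx, sum_inner]
    refine Finset.sum_congr rfl fun k _ => ?_
    rw [real_inner_smul_left, real_inner_comm]
  have hen : ∑ k ∈ F, (lam k + τ) * ⟪v, e k⟫ ^ 2 ≤ S := by
    have h1 := (hf.hasSum_energy hlam q).add ((e.hasSum_inner_sq v).mul_left τ)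
    have h2 := sum_le_hasSum F (fun k _ => by have := hlam k; positivity) h1
    refine le_trans (le_of_eq ?_) (h2.trans (le_of_eq ?_))
    · exact Finset.sum_congr rfl fun k _ => by ring
    · rw [hv, hf.f_orth.norm_sum_smul_sq, Finset.mul_sum, ← Finset.sum_add_distrib]
      refine Finset.sum_congr rfl fun j _ => ?_
      have := (hμ j).ne'
      rw [hq]; field_simp
  have hcs : S ^ 2 ≤ T * ∑ k ∈ F, (lam k + τ) * ⟪v, e k⟫ ^ 2 := by
    rw [hSv, hT]
    refine Finset.sum_sq_le_sum_mul_sum_of_sq_le_mul F (fun k _ => ?_) (fun k _ => ?_)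
      fun k _ => ?_
    · exact div_nonneg (sq_nonneg _) (hl k).le
    · exact mul_nonneg (hl k).le (sq_nonneg _)
    · have := (hl k).ne'
      refine le_of_eq ?_
      field_simp
  have hT0 : 0 ≤ T := Finset.sum_nonneg fun k _ => div_nonneg (sq_nonneg _) (hl k).le
  have hS0 : 0 ≤ S := Finset.sum_nonneg fun j _ => div_nonneg (sq_nonneg _) (hμ j).le
  rcases hS0.eq_or_lt with h0 | h0
  · rw [← h0]; exact hT0
  · have : S * S ≤ T * S := by nlinarith [mul_le_mul_of_nonneg_left hen hT0]
    exact le_of_mul_le_mul_right this h0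

/-- Comparison of fractional negative powers of the operator and of its discretization. -/
theorem sum_inner_sq_mul_rpow_le (hf : FESetup e lam N f μ) (hlam : ∀ k, 0 < lam k)
    (F : Finset ℕ) (c : ℕ → ℝ) {p : ℝ} (hp : p ∈ Ioo (0 : ℝ) 1) :
    ∑ j, ⟪∑ k ∈ F, c k • (e k : H), f j⟫ ^ 2 * μ j ^ (p - 1) ≤
      ∑ k ∈ F, c k ^ 2 * lam k ^ (p - 1) := by
  set C : ℝ := (∫ t in Ioi 0, Real.rpowIntegrand₀₁ p t 1)⁻¹ with hC
  have hC0 : 0 ≤ C := inv_nonneg.2 (setIntegral_nonneg measurableSet_Ioi fun t ht =>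
    Real.rpowIntegrand₀₁_nonneg hp.1 (le_of_lt ht) zero_le_one)
  have key : ∀ x : ℝ, 0 < x → IntegrableOn (fun t : ℝ => t ^ (p - 1) / (t + x)) (Ioi 0) ∧
      x ^ (p - 1) = C * ∫ t in Ioi 0, t ^ (p - 1) / (t + x) := by
    intro x hx
    have e1 : EqOn (fun t : ℝ => t ^ (p - 1) / (t + x))
        (fun t => x⁻¹ * Real.rpowIntegrand₀₁ p t x) (Ioi 0) := by
      intro t ht
      show _ = x⁻¹ * _
      rw [Real.rpowIntegrand₀₁_eq_pow_div hp (le_of_lt ht) hx.le]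
      field_simp
    constructor
    · exact (integrableOn_congr_fun e1 measurableSet_Ioi).2
        ((Real.integrableOn_rpowIntegrand₀₁_Ioi hp hx.le).const_mul _)
    · rw [setIntegral_congr_fun measurableSet_Ioi e1, integral_const_mul, mul_left_comm,
        ← Real.rpow_eq_const_mul_integral hp hx.le, Real.rpow_sub_one hx.ne']
      ring
  have e2 : ∀ {ι : Type} (G : Finset ι) (a : ι → ℝ) (y : ι → ℝ), (∀ i ∈ G, 0 < y i) →
      IntegrableOn (fun t : ℝ => t ^ (p - 1) * ∑ i ∈ G, a i / (y i + t)) (Ioi 0) ∧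
      ∑ i ∈ G, a i * y i ^ (p - 1) =
        C * ∫ t in Ioi 0, t ^ (p - 1) * ∑ i ∈ G, a i / (y i + t) := by
    intro ι G a y hy
    have e3 : (fun t : ℝ => t ^ (p - 1) * ∑ i ∈ G, a i / (y i + t)) =
        fun t => ∑ i ∈ G, a i * (t ^ (p - 1) / (t + y i)) := by
      ext t
      rw [Finset.mul_sum]
      exact Finset.sum_congr rfl fun i _ => by rw [add_comm]; ring
    rw [e3]
    refine ⟨integrable_finsetSum _ fun i hi => (key _ (hy i hi)).1.const_mul _, ?_⟩
    rw [integral_finsetSum _ fun i hi => (key _ (hy i hi)).1.const_mul _, Finset.mul_sum]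
    refine Finset.sum_congr rfl fun i hi => ?_
    rw [integral_const_mul, (key _ (hy i hi)).2]; ring
  rw [(e2 _ _ _ fun j _ => hf.mu_pos j).2, (e2 _ _ _ fun k _ => hlam k).2]
  refine mul_le_mul_of_nonneg_left (setIntegral_mono_on (e2 _ _ _ fun j _ => hf.mu_pos j).1
    (e2 _ _ _ fun k _ => hlam k).1 measurableSet_Ioi fun t ht => ?_) hC0
  exact mul_le_mul_of_nonneg_left (hf.sum_inner_sq_div_add_le hlam F c (le_of_lt ht))
    (Real.rpow_nonneg (le_of_lt ht) _)

end FESetup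

end Galerkin

section SemidiscreteError

variable {H : Type*} [NormedAddCommGroup H] [InnerProductSpace ℝ H]

theorem norm_sub_sq_le_two_mul (a b : H) : ‖a - b‖ ^ 2 ≤ 2 * (‖a‖ ^ 2 + ‖b‖ ^ 2) := by
  have := parallelogram_law_with_norm ℝ a b
  nlinarith [mul_self_nonneg ‖a + b‖]

theorem norm_add_sq_le_two_mul (a b : H) : ‖a + b‖ ^ 2 ≤ 2 * (‖a‖ ^ 2 + ‖b‖ ^ 2) := by
  simpa using norm_sub_sq_le_two_mul a (-b)

theorem Orthonormal.sum_inner_sq_le {ι : Type*} [Fintype ι] {f : ι → H} (hf : Orthonormal ℝ f)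
    (x : H) : ∑ j, ⟪x, f j⟫ ^ 2 ≤ ‖x‖ ^ 2 := by
  refine le_trans (le_of_eq ?_) (hf.sum_inner_products_le x (s := Finset.univ))
  refine Finset.sum_congr rfl fun j _ => ?_
  rw [real_inner_comm, Real.norm_eq_abs, sq_abs]

theorem Complex.sq_norm_eq_re_sq_add_im_sq (z : ℂ) : ‖z‖ ^ 2 = z.re ^ 2 + z.im ^ 2 := by
  rw [Complex.sq_norm, Complex.normSq_apply]; ring

namespace FESetup

variable {e : HilbertBasis ℕ ℝ H} {lam : ℕ → ℝ} {N : ℕ} {f : Fin N → H} {μ : Fin N → ℝ}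

/-- Quasi-optimality, in the Laplace domain, of the Galerkin approximation of
`(z + β A)⁻¹ x`. -/
theorem norm_symbol_error_le (hf : FESetup e lam N f μ) (hlam : ∀ k, 0 < lam k) {Rh : H → H}
    (hR : ∀ v : H, Rh v ∈ Submodule.span ℝ (range f))
    (hG : ∀ v : H, (∑' k, ENNReal.ofReal (lam k * ⟪v, e k⟫ ^ 2)) < ⊤ →
      ∀ j, (∑' k, lam k * ⟪Rh v - v, e k⟫ * ⟪f j, e k⟫) = 0)
    {B γ : ℝ}
    (hB : ∀ v : H, (∑' k, ENNReal.ofReal (lam k ^ γ * ⟪v, e k⟫ ^ 2)) < ⊤ →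
      ‖Rh v - v‖ ≤ B * Real.sqrt (∑' k, lam k ^ γ * ⟪v, e k⟫ ^ 2))
    (F : Finset ℕ) (c : ℕ → ℝ) {z β : ℂ} {M : ℝ}
    (hne : ∀ l : ℝ, 0 < l → z + l * β ≠ 0) (hM : ∀ l : ℝ, 0 < l → ‖z‖ ≤ M * ‖z + l * β‖) :
    ‖∑ k ∈ F, ((z + lam k * β)⁻¹).re • c k • (e k : H) -
        ∑ j, ((z + μ j * β)⁻¹).re • ⟪∑ k ∈ F, c k • (e k : H), f j⟫ • f j‖ ^ 2 +
      ‖∑ k ∈ F, ((z + lam k * β)⁻¹).im • c k • (e k : H) -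
        ∑ j, ((z + μ j * β)⁻¹).im • ⟪∑ k ∈ F, c k • (e k : H), f j⟫ • f j‖ ^ 2 ≤
      2 * (1 + M ^ 2) * B ^ 2 *
        ∑ k ∈ F, lam k ^ γ * c k ^ 2 * ‖(z + lam k * β)⁻¹‖ ^ 2 := by
  set x : H := ∑ k ∈ F, c k • (e k : H) with hx
  have ritz : ∀ d : ℕ → ℝ, ‖∑ k ∈ F, d k • (e k : H) - Rh (∑ k ∈ F, d k • (e k : H))‖ ^ 2 ≤
      B ^ 2 * ∑ k ∈ F, lam k ^ γ * d k ^ 2 := by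
    intro d
    set y : H := ∑ k ∈ F, d k • (e k : H) with hy
    have hyk : ∀ m, ⟪y, e m⟫ = if m ∈ F then d m else 0 := e.inner_sum_smul F d
    have hfin : (∑' k, ENNReal.ofReal (lam k ^ γ * ⟪y, e k⟫ ^ 2)) < ⊤ := by
      rw [tsum_eq_sum (s := F) fun k hk => by simp [hyk, hk]]
      exact ENNReal.sum_lt_top.2 fun _ _ => ENNReal.ofReal_lt_top
    have hsum : ∑' k, lam k ^ γ * ⟪y, e k⟫ ^ 2 = ∑ k ∈ F, lam k ^ γ * d k ^ 2 := by
      rw [tsum_eq_sum (s := F) fun k hk => by simp [hyk, hk]]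
      exact Finset.sum_congr rfl fun k hk => by simp [hyk, hk]
    have h1 := hB y hfin
    rw [hsum] at h1
    have h0 : 0 ≤ ∑ k ∈ F, lam k ^ γ * d k ^ 2 := Finset.sum_nonneg fun k _ =>
      mul_nonneg (Real.rpow_nonneg (hlam k).le _) (sq_nonneg _)
    rw [norm_sub_rev]
    calc ‖Rh y - y‖ ^ 2 ≤ (B * Real.sqrt (∑ k ∈ F, lam k ^ γ * d k ^ 2)) ^ 2 :=
          pow_le_pow_left₀ (norm_nonneg _) h1 2
      _ = _ := by rw [mul_pow, Real.sq_sqrt h0]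
  set dr : ℕ → ℝ := fun k => ((z + lam k * β)⁻¹).re * c k with hdr
  set di : ℕ → ℝ := fun k => ((z + lam k * β)⁻¹).im * c k with hdi
  set yr : H := ∑ k ∈ F, dr k • (e k : H) with hyr
  set yi : H := ∑ k ∈ F, di k • (e k : H) with hyi
  set n : Fin N → ℂ := fun j => ⟪yr - Rh yr, f j⟫ + ⟪yi - Rh yi, f j⟫ * Complex.I with hn
  have hid : ∀ j, (z + μ j * β)⁻¹ * (⟪x, f j⟫ : ℝ) =
      (⟪Rh yr, f j⟫ + ⟪Rh yi, f j⟫ * Complex.I) + z * (z + μ j * β)⁻¹ * n j := by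
    intro j
    have h1 : (μ j : ℂ) * (⟪Rh yr, f j⟫ + ⟪Rh yi, f j⟫ * Complex.I) =
        ∑ k ∈ F, lam k * (z + lam k * β)⁻¹ * c k * ⟪f j, e k⟫ := by
      have hr := hf.sum_eq_mul_inner_ritz hlam hR hG F dr j
      have hi := hf.sum_eq_mul_inner_ritz hlam hR hG F di j
      rw [mul_add, ← mul_assoc, ← Complex.ofReal_mul, ← Complex.ofReal_mul, ← hr, ← hi]
      push_cast
      rw [Finset.sum_mul, ← Finset.sum_add_distrib]
      refine Finset.sum_congr rfl fun k _ => ?_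
      simp only [hdr, hdi]
      push_cast
      linear_combination ((lam k : ℂ) * c k * ⟪f j, e k⟫) *
        Complex.re_add_im ((z + lam k * β)⁻¹)
    have h2 : (⟪Rh yr, f j⟫ + ⟪Rh yi, f j⟫ * Complex.I) + n j =
        ∑ k ∈ F, (z + lam k * β)⁻¹ * c k * ⟪f j, e k⟫ := by
      have : (⟪Rh yr, f j⟫ + ⟪Rh yi, f j⟫ * Complex.I) + n j =
          (⟪yr, f j⟫ : ℝ) + (⟪yi, f j⟫ : ℝ) * Complex.I := by
        simp only [hn, inner_sub_left]; push_cast; ring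
      rw [this, hyr, hyi, sum_inner, sum_inner]
      push_cast
      rw [Finset.sum_mul, ← Finset.sum_add_distrib]
      refine Finset.sum_congr rfl fun k _ => ?_
      rw [real_inner_smul_left, real_inner_smul_left, real_inner_comm]
      simp only [hdr, hdi]
      push_cast
      linear_combination ((c k : ℂ) * ⟪f j, e k⟫) * Complex.re_add_im ((z + lam k * β)⁻¹)
    have h3 : ((⟪x, f j⟫ : ℝ) : ℂ) = ∑ k ∈ F, (c k : ℂ) * ⟪f j, e k⟫ := by
      rw [hx, sum_inner]
      push_cast
      refine Finset.sum_congr rfl fun k _ => ?_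
      rw [real_inner_smul_left, real_inner_comm]
      push_cast; rfl
    have h4 : ((⟪x, f j⟫ : ℝ) : ℂ) =
        (z + μ j * β) * (⟪Rh yr, f j⟫ + ⟪Rh yi, f j⟫ * Complex.I) + z * n j := by
      have : (z + μ j * β) * (⟪Rh yr, f j⟫ + ⟪Rh yi, f j⟫ * Complex.I) + z * n j =
          z * ((⟪Rh yr, f j⟫ + ⟪Rh yi, f j⟫ * Complex.I) + n j) +
            β * (μ j * (⟪Rh yr, f j⟫ + ⟪Rh yi, f j⟫ * Complex.I)) := by ring
      rw [this, h1, h2, h3, Finset.mul_sum, Finset.mul_sum, ← Finset.sum_add_distrib]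
      refine Finset.sum_congr rfl fun k _ => ?_
      have := hne _ (hlam k)
      field_simp
    rw [h4]
    have := hne _ (hf.mu_pos j)
    field_simp
  have hRe : ∀ j, ((z + μ j * β)⁻¹).re * ⟪x, f j⟫ =
      ⟪Rh yr, f j⟫ + (z * (z + μ j * β)⁻¹ * n j).re := by
    intro j
    have := congrArg Complex.re (hid j)
    rw [Complex.re_mul_ofReal] at this
    rw [this]; simp
  have hIm : ∀ j, ((z + μ j * β)⁻¹).im * ⟪x, f j⟫ =
      ⟪Rh yi, f j⟫ + (z * (z + μ j * β)⁻¹ * n j).im := by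
    intro j
    have := congrArg Complex.im (hid j)
    rw [Complex.im_mul_ofReal] at this
    rw [this]; simp
  have hEr : ∑ k ∈ F, ((z + lam k * β)⁻¹).re • c k • (e k : H) -
      ∑ j, ((z + μ j * β)⁻¹).re • ⟪x, f j⟫ • f j =
        (yr - Rh yr) - ∑ j, (z * (z + μ j * β)⁻¹ * n j).re • f j := by
    simp_rw [smul_smul, hRe, add_smul, Finset.sum_add_distrib]
    rw [hf.f_orth.sum_inner_smul_eq (hR yr), sub_sub]
  have hEi : ∑ k ∈ F, ((z + lam k * β)⁻¹).im • c k • (e k : H) -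
      ∑ j, ((z + μ j * β)⁻¹).im • ⟪x, f j⟫ • f j =
        (yi - Rh yi) - ∑ j, (z * (z + μ j * β)⁻¹ * n j).im • f j := by
    simp_rw [smul_smul, hIm, add_smul, Finset.sum_add_distrib]
    rw [hf.f_orth.sum_inner_smul_eq (hR yi), sub_sub]
  rw [hEr, hEi]
  have b1 := norm_sub_sq_le_two_mul (yr - Rh yr) (∑ j, (z * (z + μ j * β)⁻¹ * n j).re • f j)
  have b2 := norm_sub_sq_le_two_mul (yi - Rh yi) (∑ j, (z * (z + μ j * β)⁻¹ * n j).im • f j)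
  rw [hf.f_orth.norm_sum_smul_sq] at b1 b2
  have b3 : ∑ j, (z * (z + μ j * β)⁻¹ * n j).re ^ 2 + ∑ j, (z * (z + μ j * β)⁻¹ * n j).im ^ 2 ≤
      M ^ 2 * (‖yr - Rh yr‖ ^ 2 + ‖yi - Rh yi‖ ^ 2) := by
    rw [← Finset.sum_add_distrib]
    calc ∑ j, ((z * (z + μ j * β)⁻¹ * n j).re ^ 2 + (z * (z + μ j * β)⁻¹ * n j).im ^ 2)
        ≤ ∑ j, M ^ 2 * (⟪yr - Rh yr, f j⟫ ^ 2 + ⟪yi - Rh yi, f j⟫ ^ 2) := by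
          refine Finset.sum_le_sum fun j _ => ?_
          have hn2 : ‖n j‖ ^ 2 = ⟪yr - Rh yr, f j⟫ ^ 2 + ⟪yi - Rh yi, f j⟫ ^ 2 := by
            rw [Complex.sq_norm_eq_re_sq_add_im_sq]; simp [hn]
          rw [← Complex.sq_norm_eq_re_sq_add_im_sq, norm_mul, mul_pow, hn2]
          refine mul_le_mul_of_nonneg_right (pow_le_pow_left₀ (norm_nonneg _) ?_ 2)
            (by positivity)
          rw [norm_mul, norm_inv, ← div_eq_mul_inv,
            div_le_iff₀ (norm_pos_iff.2 (hne _ (hf.mu_pos j)))]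
          exact hM _ (hf.mu_pos j)
      _ = M ^ 2 * (∑ j, ⟪yr - Rh yr, f j⟫ ^ 2 + ∑ j, ⟪yi - Rh yi, f j⟫ ^ 2) := by
          rw [← Finset.mul_sum, Finset.sum_add_distrib]
      _ ≤ _ := mul_le_mul_of_nonneg_left (add_le_add (hf.f_orth.sum_inner_sq_le _)
          (hf.f_orth.sum_inner_sq_le _)) (sq_nonneg _)
  have b4 : ‖yr - Rh yr‖ ^ 2 + ‖yi - Rh yi‖ ^ 2 ≤
      B ^ 2 * ∑ k ∈ F, lam k ^ γ * c k ^ 2 * ‖(z + lam k * β)⁻¹‖ ^ 2 := by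
    refine (add_le_add (ritz dr) (ritz di)).trans (le_of_eq ?_)
    rw [← mul_add, ← Finset.sum_add_distrib]
    congr 1
    refine Finset.sum_congr rfl fun k _ => ?_
    rw [Complex.sq_norm_eq_re_sq_add_im_sq]
    simp only [hdr, hdi]
    ring
  nlinarith [mul_le_mul_of_nonneg_left b4 (by positivity : 0 ≤ 1 + M ^ 2)]

end FESetup

end SemidiscreteError

section ErrorBound

variable {H : Type*} [NormedAddCommGroup H] [InnerProductSpace ℝ H]

/-- The semidiscretization error `(S(u) - S_h(u) P_h) x` for the finite expansion
`x = Σ_{k ∈ F} c_k e_k`. -/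
def semidiscreteError (e : HilbertBasis ℕ ℝ H) {N : ℕ} (f : Fin N → H) (s : ℕ → ℝ → ℝ)
    (sh : Fin N → ℝ → ℝ) (F : Finset ℕ) (c : ℕ → ℝ) (u : ℝ) : H :=
  ∑ k ∈ F, (s k u * c k) • (e k : H) -
    ∑ j, (sh j u * ⟪∑ k ∈ F, c k • (e k : H), f j⟫) • f j

theorem semidiscreteError_union (e : HilbertBasis ℕ ℝ H) {N : ℕ} (f : Fin N → H)
    (s : ℕ → ℝ → ℝ) (sh : Fin N → ℝ → ℝ) {F G : Finset ℕ} (h : Disjoint F G) (c : ℕ → ℝ) (u : ℝ) :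
    semidiscreteError e f s sh (F ∪ G) c u =
      semidiscreteError e f s sh F c u + semidiscreteError e f s sh G c u := by
  simp only [semidiscreteError, Finset.sum_union h, inner_add_left, mul_add, add_smul,
    Finset.sum_add_distrib]
  abel

variable {b b' : ℝ → ℝ} {ρ : ℝ} {e : HilbertBasis ℕ ℝ H} {lam : ℕ → ℝ} {s s' : ℕ → ℝ → ℝ}

theorem Assumption1.exists_lintegral_semidiscreteError_le_of_ritz (hb : Assumption1 b b' ρ)
    (hlam : ∀ k, 0 < lam k) (hmono : Monotone lam)
    (hs : ∀ k, IsScalarSolution b (lam k) (s k) (s' k)) :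
    ∃ C > 0, ∀ (N : ℕ) (f : Fin N → H) (μ : Fin N → ℝ), FESetup e lam N f μ →
      ∀ Rh : H → H, (∀ v : H, Rh v ∈ Submodule.span ℝ (range f)) →
      (∀ v : H, (∑' k, ENNReal.ofReal (lam k * ⟪v, e k⟫ ^ 2)) < ⊤ →
        ∀ j, (∑' k, lam k * ⟪Rh v - v, e k⟫ * ⟪f j, e k⟫) = 0) →
      ∀ B γ : ℝ, (∀ v : H, (∑' k, ENNReal.ofReal (lam k ^ γ * ⟪v, e k⟫ ^ 2)) < ⊤ →
        ‖Rh v - v‖ ≤ B * Real.sqrt (∑' k, lam k ^ γ * ⟪v, e k⟫ ^ 2)) →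
      ∀ sh sh' : Fin N → ℝ → ℝ, (∀ j, IsScalarSolution b (μ j) (sh j) (sh' j)) →
      ∀ (F : Finset ℕ) (c : ℕ → ℝ), ∀ t > 0,
        ∫⁻ u in Ioc 0 t, ENNReal.ofReal (‖semidiscreteError e f s sh F c u‖ ^ 2) ≤
          ENNReal.ofReal (C * B ^ 2 * ∑ k ∈ F, lam k ^ (γ - 1 / ρ) * c k ^ 2) := by
  obtain ⟨C, hC, hT⟩ := hb.exists_lintegral_le (hlam 0) H
  set M : ℝ := 1 + 2 / Real.cos ((ρ - 1) * (Real.pi / 2)) with hM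
  refine ⟨C * (2 * (1 + M ^ 2)), by positivity, ?_⟩
  intro N f μ hf Rh hR hG B γ hB sh sh' hsh F c t ht
  have h := hT (↥F ⊕ Fin N) ↥F (Sum.elim (fun k => lam k) μ) (Sum.elim (fun k => s k) sh)
    (Sum.elim (fun k => s' k) sh')
    (Sum.elim (fun k => c k • (e k : H)) fun j => -(⟪∑ k ∈ F, c k • (e k : H), f j⟫ • f j))
    (fun k => lam k) (fun k => lam k ^ γ * c k ^ 2) (2 * (1 + M ^ 2) * B ^ 2) (by positivity)
    (by rintro (k | j); exacts [hlam k, hf.mu_pos j])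
    (by rintro (k | j); exacts [hs k, hsh j])
    (fun k => hmono (Nat.zero_le _))
    (fun k => mul_nonneg (Real.rpow_nonneg (hlam k).le _) (sq_nonneg _))
    (fun z hz => by
      have := hf.norm_symbol_error_le hlam hR hG hB F c (z := z) (β := laplaceTransform b z)
        (M := M) (fun l hl => hb.add_mul_laplace_ne_zero hz hl) (fun l hl =>
          (le_add_of_nonneg_right (mul_nonneg hl.le (norm_nonneg _))).trans
            (hb.norm_add_le hz hl))
      simp only [Fintype.sum_sum_type, Sum.elim_inl, Sum.elim_inr, smul_neg,
        Finset.sum_neg_distrib, ← sub_eq_add_neg]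
      rw [Finset.sum_coe_sort F fun k => ((z + lam k * laplaceTransform b z)⁻¹).re •
          c k • (e k : H),
        Finset.sum_coe_sort F fun k => ((z + lam k * laplaceTransform b z)⁻¹).im •
          c k • (e k : H),
        Finset.sum_coe_sort F fun k => lam k ^ γ * c k ^ 2 *
          ‖(z + lam k * laplaceTransform b z)⁻¹‖ ^ 2]
      exact this) t ht
  simp only [Fintype.sum_sum_type, Sum.elim_inl, Sum.elim_inr, smul_neg,
    Finset.sum_neg_distrib, ← sub_eq_add_neg, smul_smul] at h
  rw [Finset.sum_coe_sort F fun k => lam k ^ γ * c k ^ 2 * lam k ^ (-(1 / ρ))] at h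
  refine le_trans (le_of_eq ?_) (h.trans (le_of_eq ?_))
  · refine lintegral_congr fun u => ?_
    rw [Finset.sum_coe_sort F fun k => (s k u * c k) • (e k : H)]
    rfl
  · congr 1
    rw [← mul_assoc]
    congr 1
    refine Finset.sum_congr rfl fun k _ => ?_
    rw [sub_eq_add_neg, Real.rpow_add (hlam k)]; ring

theorem Assumption1.exists_lintegral_semidiscreteError_le (hb : Assumption1 b b' ρ)
    (hlam : ∀ k, 0 < lam k) (hmono : Monotone lam)
    (hs : ∀ k, IsScalarSolution b (lam k) (s k) (s' k)) :
    ∃ C > 0, ∀ (N : ℕ) (f : Fin N → H) (μ : Fin N → ℝ), FESetup e lam N f μ →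
      ∀ sh sh' : Fin N → ℝ → ℝ, (∀ j, IsScalarSolution b (μ j) (sh j) (sh' j)) →
      ∀ (F : Finset ℕ) (c : ℕ → ℝ), ∀ t > 0,
        ∫⁻ u in Ioc 0 t, ENNReal.ofReal (‖semidiscreteError e f s sh F c u‖ ^ 2) ≤
          ENNReal.ofReal (C * ∑ k ∈ F, lam k ^ (-(1 / ρ)) * c k ^ 2) := by
  obtain ⟨C, hC, hT⟩ := hb.exists_lintegral_le (hlam 0) H
  refine ⟨C * 4, by positivity, ?_⟩
  intro N f μ hf sh sh' hsh F c t ht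
  set x : H := ∑ k ∈ F, c k • (e k : H) with hx
  have hF : ∀ d : ℕ → ℝ, ‖∑ k ∈ F, d k • (e k : H)‖ ^ 2 = ∑ k ∈ F, d k ^ 2 := by
    intro d
    rw [← real_inner_self_eq_norm_sq, inner_sum]
    refine Finset.sum_congr rfl fun k hk => ?_
    rw [real_inner_smul_right, e.inner_sum_smul, if_pos hk, sq]
  have h := hT (↥F ⊕ Fin N) (↥F ⊕ Fin N) (Sum.elim (fun k => lam k) μ)
    (Sum.elim (fun k => s k) sh) (Sum.elim (fun k => s' k) sh')
    (Sum.elim (fun k => c k • (e k : H)) fun j => -(⟪x, f j⟫ • f j))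
    (Sum.elim (fun k => lam k) μ) (Sum.elim (fun k => c k ^ 2) fun j => ⟪x, f j⟫ ^ 2) 2
    zero_le_two
    (by rintro (k | j); exacts [hlam k, hf.mu_pos j])
    (by rintro (k | j); exacts [hs k, hsh j])
    (by rintro (k | j); exacts [hmono (Nat.zero_le _), hf.le_eigenvalue hlam hmono j])
    (by rintro (k | j) <;> exact sq_nonneg _)
    (fun z hz => by
      simp only [Fintype.sum_sum_type, Sum.elim_inl, Sum.elim_inr, smul_neg,
        Finset.sum_neg_distrib, ← sub_eq_add_neg, smul_smul]
      rw [Finset.sum_coe_sort F fun k => (((z + lam k * laplaceTransform b z)⁻¹).re *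
          c k) • (e k : H),
        Finset.sum_coe_sort F fun k => (((z + lam k * laplaceTransform b z)⁻¹).im *
          c k) • (e k : H),
        Finset.sum_coe_sort F fun k => c k ^ 2 *
          ‖(z + lam k * laplaceTransform b z)⁻¹‖ ^ 2]
      refine (add_le_add (norm_sub_sq_le_two_mul _ _) (norm_sub_sq_le_two_mul _ _)).trans
        (le_of_eq ?_)
      rw [hF, hF, hf.f_orth.norm_sum_smul_sq, hf.f_orth.norm_sum_smul_sq, ← mul_add]
      congr 1
      rw [add_add_add_comm, ← Finset.sum_add_distrib, ← Finset.sum_add_distrib]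
      congr 1 <;> refine Finset.sum_congr rfl fun k _ => ?_ <;>
        rw [Complex.sq_norm_eq_re_sq_add_im_sq] <;> ring) t ht
  simp only [Fintype.sum_sum_type, Sum.elim_inl, Sum.elim_inr, smul_neg,
    Finset.sum_neg_distrib, ← sub_eq_add_neg, smul_smul] at h
  rw [Finset.sum_coe_sort F fun k => c k ^ 2 * lam k ^ (-(1 / ρ))] at h
  have hp : 1 - 1 / ρ ∈ Ioo (0 : ℝ) 1 := by
    have h1 := hb.rho_mem.1
    have h0 : 0 < ρ := by linarith
    have h2 : 1 / ρ < 1 := by rw [div_lt_one h0]; exact h1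
    have h3 : 0 < 1 / ρ := by positivity
    constructor <;> linarith
  have hheinz := hf.sum_inner_sq_mul_rpow_le hlam F c hp
  rw [show 1 - 1 / ρ - 1 = -(1 / ρ) by ring] at hheinz
  refine le_trans (le_of_eq ?_) (h.trans (ENNReal.ofReal_le_ofReal ?_))
  · refine lintegral_congr fun u => ?_
    rw [Finset.sum_coe_sort F fun k => (s k u * c k) • (e k : H)]
    rfl
  · have : ∑ k ∈ F, lam k ^ (-(1 / ρ)) * c k ^ 2 = ∑ k ∈ F, c k ^ 2 * lam k ^ (-(1 / ρ)) :=
      Finset.sum_congr rfl fun k _ => mul_comm _ _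
    rw [this]
    calc _ ≤ C * 2 * (∑ k ∈ F, c k ^ 2 * lam k ^ (-(1 / ρ)) +
          ∑ k ∈ F, c k ^ 2 * lam k ^ (-(1 / ρ))) := by gcongr
      _ = _ := by ring

end ErrorBound

section ErrorLimit

variable {H : Type*} [NormedAddCommGroup H] [InnerProductSpace ℝ H]
  {b b' : ℝ → ℝ} {ρ : ℝ} {e : HilbertBasis ℕ ℝ H} {lam : ℕ → ℝ} {s s' : ℕ → ℝ → ℝ}

theorem continuousOn_semidiscreteError {N : ℕ} {f : Fin N → H} {sh : Fin N → ℝ → ℝ}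
    (hs : ∀ k, ContinuousOn (s k) (Ici 0)) (hsh : ∀ j, ContinuousOn (sh j) (Ici 0))
    (F : Finset ℕ) (c : ℕ → ℝ) : ContinuousOn (semidiscreteError e f s sh F c) (Ici 0) := by
  unfold semidiscreteError
  fun_prop

theorem aemeasurable_norm_semidiscreteError_sq {N : ℕ} {f : Fin N → H} {sh : Fin N → ℝ → ℝ}
    (hs : ∀ k, ContinuousOn (s k) (Ici 0)) (hsh : ∀ j, ContinuousOn (sh j) (Ici 0))
    (F : Finset ℕ) (c : ℕ → ℝ) (t : ℝ) :
    AEMeasurable (fun u => ENNReal.ofReal (‖semidiscreteError e f s sh F c u‖ ^ 2))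
      (volume.restrict (Ioc 0 t)) := by
  have h : ContinuousOn (fun u => ‖semidiscreteError e f s sh F c u‖ ^ 2) (Ioc 0 t) :=
    ((continuousOn_semidiscreteError hs hsh F c).norm.pow 2).mono fun u hu => hu.1.le
  exact (h.aemeasurable measurableSet_Ioc).ennreal_ofReal

theorem Assumption1.exists_lintegral_semidiscreteError_le_rpow (hb : Assumption1 b b' ρ)
    (hlam : ∀ k, 0 < lam k) (hmono : Monotone lam)
    (hs : ∀ k, IsScalarSolution b (lam k) (s k) (s' k)) (CR : ℝ) :
    ∃ C > 0, ∀ h : ℝ, 0 < h →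
      ∀ (N : ℕ) (f : Fin N → H) (μ : Fin N → ℝ), FESetup e lam N f μ →
      ∀ Rh : H → H, (∀ v : H, Rh v ∈ Submodule.span ℝ (range f)) →
      (∀ v : H, (∑' k, ENNReal.ofReal (lam k * ⟪v, e k⟫ ^ 2)) < ⊤ →
        ∀ j, (∑' k, lam k * ⟪Rh v - v, e k⟫ * ⟪f j, e k⟫) = 0) →
      (∀ γ ∈ Icc (1 : ℝ) 2, ∀ v : H, (∑' k, ENNReal.ofReal (lam k ^ γ * ⟪v, e k⟫ ^ 2)) < ⊤ →
        ‖Rh v - v‖ ≤ CR * h ^ γ * Real.sqrt (∑' k, lam k ^ γ * ⟪v, e k⟫ ^ 2)) →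
      ∀ sh sh' : Fin N → ℝ → ℝ, (∀ j, IsScalarSolution b (μ j) (sh j) (sh' j)) →
      ∀ ν ∈ Icc (0 : ℝ) 2, ∀ (F : Finset ℕ) (c : ℕ → ℝ), ∀ t > 0,
        ∫⁻ u in Ioc 0 t, ENNReal.ofReal (‖semidiscreteError e f s sh F c u‖ ^ 2) ≤
          ENNReal.ofReal (C * h ^ (2 * ν) * ∑ k ∈ F, lam k ^ (ν - 1 / ρ) * c k ^ 2) := by
  obtain ⟨A, hA, hAb⟩ := hb.exists_lintegral_semidiscreteError_le_of_ritz (e := e) hlam hmono hs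
  obtain ⟨B, hB, hBb⟩ := hb.exists_lintegral_semidiscreteError_le (e := e) hlam hmono hs
  refine ⟨2 * (A * CR ^ 2 + B), by positivity, ?_⟩
  intro h hh N f μ hf Rh hR hG hRitz sh sh' hsh ν hν F c t ht
  have hterm : ∀ (a : ℝ) (k : ℕ), 0 ≤ lam k ^ a * c k ^ 2 := fun a k =>
    mul_nonneg (Real.rpow_nonneg (hlam k).le _) (sq_nonneg _)
  have hsum : ∀ (a : ℝ) (G : Finset ℕ), 0 ≤ ∑ k ∈ G, lam k ^ a * c k ^ 2 := fun a G =>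
    Finset.sum_nonneg fun k _ => hterm a k
  have hpow : ∀ γ : ℝ, (h ^ γ) ^ 2 = h ^ (2 * γ) := fun γ => by
    rw [mul_comm, Real.rpow_mul hh.le, Real.rpow_two]
  have hh0 : 0 ≤ h ^ (2 * ν) := Real.rpow_nonneg hh.le _
  rcases le_total 1 ν with h1 | h1
  · refine (hAb N f μ hf Rh hR hG (CR * h ^ ν) ν (hRitz ν ⟨h1, hν.2⟩) sh sh' hsh F c t ht).trans
      (ENNReal.ofReal_le_ofReal ?_)
    refine mul_le_mul_of_nonneg_right ?_ (hsum _ _)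
    rw [mul_pow, hpow, ← mul_assoc]
    exact mul_le_mul_of_nonneg_right (by nlinarith [mul_nonneg hA.le (sq_nonneg CR)]) hh0
  · set L := F.filter fun k => h ^ 2 * lam k ≤ 1 with hL
    set G := F.filter fun k => ¬ h ^ 2 * lam k ≤ 1 with hG'
    have hLG : L ∪ G = F := Finset.filter_union_filter_not_eq _ _
    have hdisj : Disjoint L G := Finset.disjoint_filter_filter_not _ _ _
    have hsplit : ∀ a : ℝ, ∑ k ∈ F, lam k ^ a * c k ^ 2 =
        ∑ k ∈ L, lam k ^ a * c k ^ 2 + ∑ k ∈ G, lam k ^ a * c k ^ 2 := fun a => by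
      rw [← Finset.sum_union hdisj, hLG]
    have hmix : ∀ k, (h ^ 2 * lam k) ^ ν = h ^ (2 * ν) * lam k ^ ν := fun k => by
      rw [Real.mul_rpow (sq_nonneg h) (hlam k).le, ← Real.rpow_two, ← Real.rpow_mul hh.le]
    have hadd : ∀ (a : ℝ) (k : ℕ), lam k ^ (a - 1 / ρ) = lam k ^ a * lam k ^ (-(1 / ρ)) :=
      fun a k => by rw [sub_eq_add_neg, Real.rpow_add (hlam k)]
    have hlow := hAb N f μ hf Rh hR hG (CR * h ^ (1 : ℝ)) 1 (hRitz 1 ⟨le_rfl, one_le_two⟩)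
      sh sh' hsh L c t ht
    have hhigh := hBb N f μ hf sh sh' hsh G c t ht
    have hlow2 : A * (CR * h ^ (1 : ℝ)) ^ 2 * ∑ k ∈ L, lam k ^ (1 - 1 / ρ) * c k ^ 2 ≤
        A * CR ^ 2 * (h ^ (2 * ν) * ∑ k ∈ L, lam k ^ (ν - 1 / ρ) * c k ^ 2) := by
      rw [Real.rpow_one, mul_pow, ← mul_assoc, mul_assoc]
      refine mul_le_mul_of_nonneg_left ?_ (by positivity)
      rw [Finset.mul_sum, Finset.mul_sum]
      refine Finset.sum_le_sum fun k hk => ?_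
      have hk1 : h ^ 2 * lam k ≤ 1 := (Finset.mem_filter.1 hk).2
      have hk2 : h ^ 2 * lam k ≤ h ^ (2 * ν) * lam k ^ ν := by
        rw [← hmix]
        have := Real.rpow_le_rpow_of_exponent_ge (mul_pos (pow_pos hh 2) (hlam k)) hk1 h1
        rwa [Real.rpow_one] at this
      rw [hadd, hadd, Real.rpow_one]
      calc h ^ 2 * (lam k * lam k ^ (-(1 / ρ)) * c k ^ 2)
          = (h ^ 2 * lam k) * (lam k ^ (-(1 / ρ)) * c k ^ 2) := by ring
        _ ≤ (h ^ (2 * ν) * lam k ^ ν) * (lam k ^ (-(1 / ρ)) * c k ^ 2) :=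
          mul_le_mul_of_nonneg_right hk2 (hterm _ k)
        _ = _ := by ring
    have hhigh2 : B * ∑ k ∈ G, lam k ^ (-(1 / ρ)) * c k ^ 2 ≤
        B * (h ^ (2 * ν) * ∑ k ∈ G, lam k ^ (ν - 1 / ρ) * c k ^ 2) := by
      refine mul_le_mul_of_nonneg_left ?_ hB.le
      rw [Finset.mul_sum]
      refine Finset.sum_le_sum fun k hk => ?_
      have hk1 : 1 ≤ h ^ 2 * lam k := (not_le.1 (Finset.mem_filter.1 hk).2).le
      have hk2 : 1 ≤ h ^ (2 * ν) * lam k ^ ν := by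
        rw [← hmix]
        exact Real.one_le_rpow hk1 hν.1
      rw [hadd]
      calc lam k ^ (-(1 / ρ)) * c k ^ 2 = 1 * (lam k ^ (-(1 / ρ)) * c k ^ 2) := (one_mul _).symm
        _ ≤ (h ^ (2 * ν) * lam k ^ ν) * (lam k ^ (-(1 / ρ)) * c k ^ 2) :=
          mul_le_mul_of_nonneg_right hk2 (hterm _ k)
        _ = _ := by ring
    have hmeas := aemeasurable_norm_semidiscreteError_sq (e := e) (f := f)
      (fun k => (hs k).cont) (fun j => (hsh j).cont) L c t
    calc ∫⁻ u in Ioc 0 t, ENNReal.ofReal (‖semidiscreteError e f s sh F c u‖ ^ 2)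
        ≤ ∫⁻ u in Ioc 0 t, ENNReal.ofReal 2 *
            (ENNReal.ofReal (‖semidiscreteError e f s sh L c u‖ ^ 2) +
              ENNReal.ofReal (‖semidiscreteError e f s sh G c u‖ ^ 2)) := by
          refine lintegral_mono fun u => ?_
          rw [← hLG, semidiscreteError_union e f s sh hdisj,
            ← ENNReal.ofReal_add (sq_nonneg _) (sq_nonneg _), ← ENNReal.ofReal_mul zero_le_two]
          exact ENNReal.ofReal_le_ofReal (norm_add_sq_le_two_mul _ _)
      _ = ENNReal.ofReal 2 *
            ((∫⁻ u in Ioc 0 t, ENNReal.ofReal (‖semidiscreteError e f s sh L c u‖ ^ 2)) +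
              ∫⁻ u in Ioc 0 t, ENNReal.ofReal (‖semidiscreteError e f s sh G c u‖ ^ 2)) := by
          rw [lintegral_const_mul' _ _ ENNReal.ofReal_ne_top, lintegral_add_left' hmeas]
      _ ≤ ENNReal.ofReal 2 *
            (ENNReal.ofReal (A * CR ^ 2 *
                (h ^ (2 * ν) * ∑ k ∈ L, lam k ^ (ν - 1 / ρ) * c k ^ 2)) +
              ENNReal.ofReal (B * (h ^ (2 * ν) * ∑ k ∈ G, lam k ^ (ν - 1 / ρ) * c k ^ 2))) := by
          gcongr
          · exact hlow.trans (ENNReal.ofReal_le_ofReal hlow2)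
          · exact hhigh.trans (ENNReal.ofReal_le_ofReal hhigh2)
      _ ≤ _ := by
          have hL0 := mul_nonneg hh0 (hsum (ν - 1 / ρ) L)
          have hG0 := mul_nonneg hh0 (hsum (ν - 1 / ρ) G)
          have hAC : 0 ≤ A * CR ^ 2 := by positivity
          rw [← ENNReal.ofReal_add (mul_nonneg hAC hL0) (mul_nonneg hB.le hG0),
            ← ENNReal.ofReal_mul zero_le_two]
          refine ENNReal.ofReal_le_ofReal ?_
          rw [hsplit]
          nlinarith [mul_nonneg hAC hG0, mul_nonneg hB.le hL0]

theorem hasSum_Sop [CompleteSpace H] (e : HilbertBasis ℕ ℝ H) {u : ℝ}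
    (hs : ∀ k, |s k u| ≤ 1) (x : H) :
    HasSum (fun k => (s k u * ⟪x, e k⟫) • (e k : H)) (Sop e s u x) := by
  refine Summable.hasSum ?_
  have hmem : Memℓp (fun k => s k u * ⟪x, e k⟫) 2 := by
    refine memℓp_gen ?_
    refine (e.hasSum_inner_sq x).summable.of_nonneg_of_le (fun k => by positivity) fun k => ?_
    have : ‖s k u * ⟪x, e k⟫‖ ≤ |⟪x, e k⟫| := by
      rw [Real.norm_eq_abs, abs_mul]
      exact mul_le_of_le_one_left (abs_nonneg _) (hs k)
    simpa using pow_le_pow_left₀ (norm_nonneg _) this 2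
  exact (e.hasSum_repr_symm ⟨_, hmem⟩).summable

theorem tendsto_semidiscreteError [CompleteSpace H] {N : ℕ} {f : Fin N → H}
    {sh : Fin N → ℝ → ℝ} {u : ℝ} (hs : ∀ k, |s k u| ≤ 1) (x : H) :
    Tendsto (fun K => semidiscreteError e f s sh (Finset.range K) (fun k => ⟪x, e k⟫) u) atTop
      (nhds (Sop e s u x - ∑ j, (sh j u * ⟪x, f j⟫) • f j)) := by
  refine (hasSum_Sop e hs x).tendsto_sum_nat.sub (tendsto_finsetSum _ fun j _ => ?_)
  have hx : HasSum (fun k => ⟪x, e k⟫ • (e k : H)) x := by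
    have := e.hasSum_repr x
    simp_rw [e.repr_apply_apply, real_inner_comm x] at this
    exact this
  exact ((hx.tendsto_sum_nat.inner tendsto_const_nhds).const_mul _).smul_const _

end ErrorLimit

/-- the noise contribution to the strong error of the spatial
semidiscretization:
`Σ_i ∫₀ᵗ ‖(S(u) - S_h(u)P_h) Q^{1/2} e_i‖² du ≤ C h^{2ν} Σ_i Σ_j λ_j^{ν-1/ρ} (Q^{1/2}e_i,e_j)²`
for `0 ≤ ν ≤ 2`, with `C` independent of `h`. -/
theorem statement11 {H : Type*} [NormedAddCommGroup H] [InnerProductSpace ℝ H]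
    [CompleteSpace H]
    (b b' : ℝ → ℝ) (ρ : ℝ) (hb : Assumption1 b b' ρ)
    (e : HilbertBasis ℕ ℝ H) (lam : ℕ → ℝ)
    (hlam_pos : ∀ k, 0 < lam k) (hlam_mono : Monotone lam)
    (hlam_top : Tendsto lam atTop atTop)
    (s s' : ℕ → ℝ → ℝ) (hs : ∀ k, IsScalarSolution b (lam k) (s k) (s' k))
    (Q Qhalf : H →L[ℝ] H)
    (hQ_sa : ∀ x y : H, ⟪Q x, y⟫ = ⟪x, Q y⟫) (hQ_nonneg : ∀ x : H, 0 ≤ ⟪Q x, x⟫)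
    (hQhalf_sa : ∀ x y : H, ⟪Qhalf x, y⟫ = ⟪x, Qhalf y⟫)
    (hQhalf_nonneg : ∀ x : H, 0 ≤ ⟪Qhalf x, x⟫)
    (hQhalf_sq : ∀ x : H, Qhalf (Qhalf x) = Q x)
    (CR : ℝ) (hCR : 0 < CR) :
    ∃ C > 0, ∀ h : ℝ, 0 < h →
      ∀ (N : ℕ) (f : Fin N → H) (μ : Fin N → ℝ), FESetup e lam N f μ →
      ∀ Rh : H → H,
        (∀ v : H, Rh v ∈ Submodule.span ℝ (Set.range f)) →
        (∀ v : H, (∑' k, ENNReal.ofReal (lam k * ⟪v, e k⟫ ^ 2)) < ⊤ →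
          ∀ j, (∑' k, lam k * ⟪Rh v - v, e k⟫ * ⟪f j, e k⟫) = 0) →
        (∀ γ ∈ Set.Icc (1 : ℝ) 2, ∀ v : H,
          (∑' k, ENNReal.ofReal (lam k ^ γ * ⟪v, e k⟫ ^ 2)) < ⊤ →
          ‖Rh v - v‖ ≤ CR * h ^ γ * Real.sqrt (∑' k, lam k ^ γ * ⟪v, e k⟫ ^ 2)) →
      ∀ sh sh' : Fin N → ℝ → ℝ, (∀ j, IsScalarSolution b (μ j) (sh j) (sh' j)) →
      ∀ ν ∈ Set.Icc (0 : ℝ) 2, ∀ t > 0,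
        (∑' i, ∫⁻ u in Set.Ioc (0 : ℝ) t,
            ENNReal.ofReal
              (‖Sop e s u (Qhalf (e i)) -
                  ∑ j, (sh j u * ⟪Qhalf (e i), f j⟫) • f j‖ ^ 2)) ≤
          ENNReal.ofReal (C * h ^ (2 * ν)) *
            ∑' i, ∑' j, ENNReal.ofReal (lam j ^ (ν - 1 / ρ) * ⟪Qhalf (e i), e j⟫ ^ 2) := by
  obtain ⟨C, hC, hbound⟩ :=
    hb.exists_lintegral_semidiscreteError_le_rpow (e := e) hlam_pos hlam_mono hs CR
  refine ⟨C, hC, ?_⟩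
  intro h hh N f μ hf Rh hR hG hRitz sh sh' hsh ν hν t ht
  rw [← ENNReal.tsum_mul_left]
  refine ENNReal.tsum_le_tsum fun i => ?_
  set x : H := Qhalf (e i)
  have hlim : ∀ u ∈ Ioc 0 t, ENNReal.ofReal
      (‖Sop e s u x - ∑ j, (sh j u * ⟪x, f j⟫) • f j‖ ^ 2) =
        liminf (fun K => ENNReal.ofReal
          (‖semidiscreteError e f s sh (Finset.range K) (fun k => ⟪x, e k⟫) u‖ ^ 2)) atTop :=
    fun u hu => (ENNReal.tendsto_ofReal ((tendsto_semidiscreteError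
      (fun k => (hs k).abs_le_one hb (hlam_pos k) hu.1) x).norm.pow 2)).liminf_eq.symm
  rw [setLIntegral_congr_fun measurableSet_Ioc hlim]
  refine (lintegral_liminf_le' fun K => aemeasurable_norm_semidiscreteError_sq
    (fun k => (hs k).cont) (fun j => (hsh j).cont) _ _ t).trans ?_
  refine liminf_le_of_frequently_le' (Frequently.of_forall fun K => ?_)
  have hterm : ∀ k, 0 ≤ lam k ^ (ν - 1 / ρ) * ⟪x, e k⟫ ^ 2 := fun k =>
    mul_nonneg (Real.rpow_nonneg (hlam_pos k).le _) (sq_nonneg _)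
  refine (hbound h hh N f μ hf Rh hR hG hRitz sh sh' hsh ν hν (Finset.range K) _ t ht).trans ?_
  rw [ENNReal.ofReal_mul (mul_nonneg hC.le (Real.rpow_nonneg hh.le _)),
    ENNReal.ofReal_sum_of_nonneg fun k _ => hterm k]
  gcongr
  exact ENNReal.sum_le_tsum _
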